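/- Assume Schanuel's Conjecture. Fix k ≥ 2 and let p ∈ ℚ^alg[x₀,…,x_k] be a nonzero irreducible polynomial depending on x₀ and x_k. Then there exists a ∈ ℂ with p(a, e₁(a), …, e_k(a)) = 0 such that td_ℚ(a, e₁(a), …, e_k(a)) ∉ {0, 1, k−1}. -/

import Mathlib

open MvPolynomial

/-- **Schanuel's Conjecture**: if `λ₁,…,λₙ ∈ ℂ` are `ℚ`-linearly independent,
then the set `{λ₁,…,λₙ,e^{λ₁},…,e^{λₙ}}` contains `n` algebraically
independent elements (transcendence degree at least `n`). -/
def SchanuelConjecture : Prop :=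
  ∀ (n : ℕ) (l : Fin n → ℂ), LinearIndependent ℚ l →
    ∃ f : Fin n → ℂ,
      (∀ i, f i ∈ Set.range l ∪ Set.range (fun i => Complex.exp (l i))) ∧
      AlgebraicIndependent ℚ f

/-- `HasTrdeg S d` says that the transcendence degree over `ℚ` of the field
generated by the set `S ⊆ ℂ` equals `d`: `S` contains `d` algebraically
independent elements, and no more. -/
def HasTrdeg (S : Set ℂ) (d : ℕ) : Prop :=
  (∃ f : Fin d → ℂ, (∀ i, f i ∈ S) ∧ AlgebraicIndependent ℚ f) ∧
    ∀ (e : ℕ) (g : Fin e → ℂ), (∀ i, g i ∈ S) → AlgebraicIndependent ℚ g → e ≤ d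

/-- Iterated exponentials: `iterExp 0 z = z` and `iterExp (j+1) z = e^{iterExp j z}`. -/
noncomputable def iterExp : ℕ → ℂ → ℂ
  | 0, z => z
  | j + 1, z => Complex.exp (iterExp j z)

open Filter Topology

theorem tendsto_prod_pow_div_zero {ι : Type} {F : Filter ι} {k : ℕ} (r : Fin k → ι → ℝ)
    (R : ι → ℝ) (hR : Tendsto R F atTop)
    (h : ∀ i, ∀ N : ℕ, Tendsto (fun n => r i n ^ N / R n) F (𝓝 0)) (m : Fin k → ℕ) :
    Tendsto (fun n => (∏ i, r i n ^ m i) / R n) F (𝓝 0) := by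
  rcases Nat.eq_zero_or_pos k with rfl | hk
  · simpa using (show Tendsto (fun n => (R n)⁻¹) F (𝓝 0) from hR.inv_tendsto_atTop)
  have h1 : Tendsto (fun n => ∏ i, (r i n ^ (m i * k) / R n)) F (𝓝 0) := by
    have := tendsto_finsetProd (Finset.univ : Finset (Fin k))
      (fun i _ => h i (m i * k))
    simpa [hk.ne'] using this
  have h2 : Tendsto (fun n => ((∏ i, r i n ^ m i) / R n) ^ k) F (𝓝 0) := by
    refine h1.congr fun n => ?_
    simp [Finset.prod_div_distrib, div_pow, Finset.prod_pow, pow_mul]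
  rw [tendsto_zero_iff_norm_tendsto_zero] at h2 ⊢
  have h3 := (Real.continuousAt_rpow_const 0 ((k : ℝ)⁻¹) (Or.inr (by positivity))).tendsto.comp h2
  rw [Real.zero_rpow (by positivity)] at h3
  refine h3.congr fun n => ?_
  simp only [Function.comp, norm_pow]
  exact Real.pow_rpow_inv_natCast (norm_nonneg _) hk.ne'

theorem exists_tendsto_eval_div_monomial {k : ℕ} (c : Fin k → ℂ) (hc : ∀ i, c i ≠ 0)
    (P : MvPolynomial (Fin k) ℂ) (hP : P ≠ 0) :
    ∃ m : Fin k → ℕ, ∃ C : ℂ, C ≠ 0 ∧ ∀ {ι : Type} (F : Filter ι) (r : Fin k → ι → ℝ)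
      (u : Fin k → ι → ℂ), (∀ i, Tendsto (r i) F atTop) →
      (∀ i j, i < j → ∀ N : ℕ, Tendsto (fun n => r j n ^ N / r i n) F (𝓝 0)) →
      (∀ i, Tendsto (fun n => u i n / (r i n : ℂ)) F (𝓝 (c i))) →
      Tendsto (fun n => eval (fun i => u i n) P / ((∏ i, r i n ^ m i : ℝ) : ℂ)) F (𝓝 C) := by
  induction k with
  | zero =>
    obtain ⟨a, rfl⟩ : ∃ a, P = MvPolynomial.C a := ⟨_, eq_C_of_isEmpty P⟩
    refine ⟨0, a, fun h => hP (by simp [h]), fun F r u _ _ _ => ?_⟩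
    simpa using tendsto_const_nhds
  | succ k ih =>
    set p := finSuccEquiv ℂ k P with hp
    have hp0 : p ≠ 0 := by simpa [hp] using hP
    set d := p.natDegree with hd
    have IH : ∀ j, ∃ m : Fin k → ℕ, ∃ C : ℂ, (p.coeff j ≠ 0 → C ≠ 0) ∧
      ∀ {ι : Type} (F : Filter ι) (r : Fin k → ι → ℝ)
      (u : Fin k → ι → ℂ), (∀ i, Tendsto (r i) F atTop) →
      (∀ i j, i < j → ∀ N : ℕ, Tendsto (fun n => r j n ^ N / r i n) F (𝓝 0)) →
      (∀ i, Tendsto (fun n => u i n / (r i n : ℂ)) F (𝓝 (c i.succ))) →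
      Tendsto (fun n => eval (fun i => u i n) (p.coeff j) / ((∏ i, r i n ^ m i : ℝ) : ℂ)) F
        (𝓝 C) := by
      intro j
      by_cases hj : p.coeff j = 0
      · refine ⟨0, 0, fun h => (h hj).elim, fun F r u _ _ _ => ?_⟩
        simpa [hj] using tendsto_const_nhds
      · obtain ⟨m, C, hC, H⟩ := ih (fun i => c i.succ) (fun i => hc _) _ hj
        exact ⟨m, C, fun _ => hC, H⟩
    choose m C hC H using IH
    have hlead : p.coeff d ≠ 0 := by simpa [hd] using hp0
    refine ⟨Fin.cons d (m d), C d * c 0 ^ d, mul_ne_zero (hC d hlead) (pow_ne_zero _ (hc 0)), ?_⟩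
    intro ι F r u hr hdom hu
    have hu0 := hu 0
    have hpos : ∀ᶠ n in F, ∀ i, 1 ≤ r i n :=
      eventually_all.2 fun i => (hr i).eventually_ge_atTop 1
    have hA : ∀ j, Tendsto (fun n => eval (fun i : Fin k => u i.succ n) (p.coeff j) /
        ((∏ i, r i.succ n ^ m j i : ℝ) : ℂ)) F (𝓝 (C j)) := fun j =>
      H j F (fun i => r i.succ) (fun i => u i.succ) (fun i => hr _)
        (fun i j hij => hdom _ _ (Fin.succ_lt_succ_iff.2 hij)) (fun i => hu _)
    have hB : ∀ j < d, Tendsto (fun n => (∏ i : Fin k, r i.succ n ^ m j i) /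
        ((∏ i : Fin k, r i.succ n ^ m d i) * r 0 n ^ (d - j))) F (𝓝 0) := by
      intro j hj
      have h1 := tendsto_prod_pow_div_zero (F := F) (fun i : Fin k => r i.succ) (r 0) (hr 0)
        (fun i N => hdom 0 i.succ (Fin.succ_pos i) N) (m j)
      refine squeeze_zero' ?_ ?_ h1
      · filter_upwards [hpos] with n hn
        have : ∀ i, 0 ≤ r i n := fun i => zero_le_one.trans (hn i)
        exact div_nonneg (Finset.prod_nonneg fun i _ => pow_nonneg (this _) _)
          (mul_nonneg (Finset.prod_nonneg fun i _ => pow_nonneg (this _) _) (pow_nonneg (this _) _))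
      · filter_upwards [hpos] with n hn
        have h0 : ∀ i, 0 ≤ r i n := fun i => zero_le_one.trans (hn i)
        have h2 : 1 ≤ ∏ i : Fin k, r i.succ n ^ m d i :=
          Finset.prod_induction _ (1 ≤ ·) (fun _ _ ha hb => one_le_mul_of_one_le_of_one_le ha hb)
            le_rfl fun i _ => one_le_pow₀ (hn _)
        have h3 : r 0 n ≤ r 0 n ^ (d - j) := le_self_pow₀ (hn 0) (by omega)
        have h4 : r 0 n ≤ (∏ i : Fin k, r i.succ n ^ m d i) * r 0 n ^ (d - j) :=
          h3.trans (le_mul_of_one_le_left (pow_nonneg (h0 _) _) h2)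
        exact div_le_div_of_nonneg_left (Finset.prod_nonneg fun i _ => pow_nonneg (h0 _) _)
          (zero_lt_one.trans_le (hn 0)) h4
    have hterm : ∀ j ∈ Finset.range (d + 1), Tendsto (fun n =>
        eval (fun i : Fin k => u i.succ n) (p.coeff j) * u 0 n ^ j /
          (((r 0 n) ^ d * ∏ i : Fin k, r i.succ n ^ m d i : ℝ) : ℂ)) F
        (𝓝 (if j = d then C d * c 0 ^ d else 0)) := by
      intro j hj
      rcases eq_or_ne j d with hjd | hjd
      · rw [hjd]
        have := (hA d).mul (hu0.pow d)
        simp only [if_true]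
        refine this.congr fun n => ?_
        push_cast
        rw [div_pow, div_mul_div_comm, mul_comm (∏ i, _)]
      · have hlt : j < d := by have := Finset.mem_range.1 hj; omega
        have hB' := (Complex.continuous_ofReal.tendsto 0).comp (hB j hlt)
        have := ((hA j).mul (hu0.pow j)).mul hB'
        simp only [hjd, if_false]
        rw [Complex.ofReal_zero, mul_zero] at this
        refine this.congr' ?_
        filter_upwards [hpos] with n hn
        have hne : ∀ i, (r i n : ℂ) ≠ 0 := fun i =>
          Complex.ofReal_ne_zero.2 (zero_lt_one.trans_le (hn i)).ne'
        have hp1 : ∀ m : Fin k → ℕ, (∏ i : Fin k, (r i.succ n : ℂ) ^ m i) ≠ 0 := fun m =>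
          Finset.prod_ne_zero_iff.2 fun i _ => pow_ne_zero _ (hne _)
        have hpow : (r 0 n : ℂ) ^ d = (r 0 n : ℂ) ^ j * (r 0 n : ℂ) ^ (d - j) := by
          rw [← pow_add]; congr 1; omega
        simp only [Function.comp]
        push_cast
        rw [hpow]
        have := hp1 (m j); have := hp1 (m d); have := hne 0
        rw [div_pow]
        field_simp
    have hsum := tendsto_finsetSum _ hterm
    rw [Finset.sum_ite_eq' (Finset.range (d + 1)) d, if_pos (by simp)] at hsum
    refine hsum.congr fun n => ?_
    have hcons : (fun i => u i n) = Fin.cons (u 0 n) (fun i : Fin k => u i.succ n) := by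
      ext i; refine Fin.cases ?_ (fun i => ?_) i <;> simp
    rw [hcons, eval_eq_eval_mv_eval', ← hp, Polynomial.eval_map,
      Polynomial.eval₂_eq_sum_range, ← Finset.sum_div, Fin.prod_univ_succ, ← hd]
    simp

theorem tendsto_log_div_log {ι : Type} {F : Filter ι} {r : ι → ℝ} {u : ι → ℂ} {c : ℂ}
    (hr : Tendsto r F atTop) (hc : c ∈ Complex.slitPlane)
    (hu : Tendsto (fun n => u n / (r n : ℂ)) F (𝓝 c)) :
    Tendsto (fun n => Complex.log (u n) / ((Real.log (r n) : ℝ) : ℂ)) F (𝓝 1) := by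
  have h1 : Tendsto (fun n => Complex.log (u n / r n)) F (𝓝 (Complex.log c)) := hu.clog hc
  have hlr : Tendsto (fun n => Real.log (r n)) F atTop := Real.tendsto_log_atTop.comp hr
  have h2 : Tendsto (fun n => ((Real.log (r n) : ℝ) : ℂ)⁻¹) F (𝓝 0) := by
    have := (Complex.continuous_ofReal.tendsto 0).comp hlr.inv_tendsto_atTop
    refine (this.congr fun n => ?_)
    simp
  have h3 := (h1.mul h2).const_add 1
  rw [mul_zero, add_zero] at h3
  refine h3.congr' ?_
  filter_upwards [hr.eventually_gt_atTop 0, hlr.eventually_gt_atTop 0,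
    hu.eventually_ne (Complex.slitPlane_ne_zero hc)] with n hn hl hne
  have hrn : (r n : ℂ) ≠ 0 := Complex.ofReal_ne_zero.2 hn.ne'
  have hl' : ((Real.log (r n) : ℝ) : ℂ) ≠ 0 := Complex.ofReal_ne_zero.2 hl.ne'
  have : Complex.log (u n) = Real.log (r n) + Complex.log (u n / r n) := by
    rw [← Complex.log_ofReal_mul hn hne]; congr 1; field_simp
  rw [this]; field_simp

theorem eventually_mem_slitPlane {ι : Type} {F : Filter ι} {r : ι → ℝ} {u : ι → ℂ} {c : ℂ}
    (hr : Tendsto r F atTop) (hc : c ∈ Complex.slitPlane)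
    (hu : Tendsto (fun n => u n / (r n : ℂ)) F (𝓝 c)) :
    ∀ᶠ n in F, u n ∈ Complex.slitPlane := by
  filter_upwards [hu.eventually (Complex.isOpen_slitPlane.mem_nhds hc),
    hr.eventually_gt_atTop 0] with n hn h0
  have hrn : (r n : ℂ) ≠ 0 := Complex.ofReal_ne_zero.2 h0.ne'
  have h1 : u n = r n * (u n / r n) := by field_simp
  have hn' := Complex.mem_slitPlane_iff.1 hn
  rw [Complex.mem_slitPlane_iff, h1, Complex.re_ofReal_mul, Complex.im_ofReal_mul]
  exact hn'.imp (fun h => mul_pos h0 h) (fun h => mul_ne_zero h0.ne' h)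

theorem tendsto_iterate_log_atTop (j : ℕ) : Tendsto (Real.log^[j]) atTop atTop := by
  induction j with
  | zero => exact tendsto_id
  | succ j ih => rw [Function.iterate_succ]; exact ih.comp Real.tendsto_log_atTop

theorem eventually_iterate_log_le (j : ℕ) : ∀ᶠ x in atTop, Real.log^[j] x ≤ x := by
  induction j with
  | zero => simp
  | succ j ih =>
    filter_upwards [ih, (tendsto_iterate_log_atTop j).eventually_ge_atTop 0] with x hx h0
    rw [Function.iterate_succ_apply']
    exact (Real.log_le_self h0).trans hx

theorem tendsto_iterate_log_pow_div (j N : ℕ) :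
    Tendsto (fun x => (Real.log^[j + 1] x) ^ N / x) atTop (𝓝 0) := by
  refine squeeze_zero' ?_ ?_
    ((Real.isLittleO_pow_log_id_atTop (n := N)).tendsto_div_nhds_zero)
  · filter_upwards [(tendsto_iterate_log_atTop (j + 1)).eventually_ge_atTop 0,
      eventually_ge_atTop 0] with x hx h0
    positivity
  · filter_upwards [(tendsto_iterate_log_atTop (j + 1)).eventually_ge_atTop 0,
      eventually_ge_atTop 0, Real.tendsto_log_atTop.eventually (eventually_iterate_log_le j)]
      with x hx h0 hl
    rw [Function.iterate_succ_apply] at hx ⊢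
    simp only [id]
    gcongr

theorem exists_zero_of_tendsto_sub {F : Filter ℕ} {f : ℕ → ℂ → ℂ} {G : ℂ → ℂ} {z : ℂ} {r : ℝ}
    (hr0 : 0 < r) (hr1 : r ≤ 1) (hG : Continuous G) (hz : G z = 0)
    (hsph : ∀ y ∈ Metric.sphere z r, G y ≠ 0)
    (hlim : Tendsto (fun x : ℕ × ℂ => f x.1 x.2 - G x.2) (F ×ˢ 𝓟 (Metric.closedBall z 1)) (𝓝 0))
    (hf : ∀ᶠ n in F, DifferentiableOn ℂ (f n) (Metric.closedBall z 1)) :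
    ∀ᶠ n in F, ∃ y ∈ Metric.closedBall z 1, f n y = 0 := by
  obtain ⟨y₀, hy₀, hmin⟩ := (isCompact_sphere z r).exists_isMinOn
    (NormedSpace.sphere_nonempty.2 hr0.le) hG.norm.continuousOn
  set ε := ‖G y₀‖ with hε
  have hε0 : 0 < ε := norm_pos_iff.2 (hsph _ hy₀)
  have hsub : Metric.closedBall z r ⊆ Metric.closedBall z 1 :=
    Metric.closedBall_subset_closedBall hr1
  have hev := eventually_prod_principal_iff.1
    (hlim.eventually (Metric.ball_mem_nhds 0 (by positivity : 0 < ε / 4)))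
  filter_upwards [hev, hf] with n hn hd
  by_contra! hne
  have hd' : DiffContOnCl ℂ (f n) (Metric.ball z r) := by
    refine DifferentiableOn.diffContOnCl (hd.mono ?_)
    rw [closure_ball z hr0.ne']
    exact hsub
  have hcl : closure (Metric.ball z r) = Metric.closedBall z r := closure_ball z hr0.ne'
  have hinv := hd'.inv (fun y hy => hne y (hsub (hcl ▸ hy)))
  have hb : ∀ y ∈ frontier (Metric.ball z r), ‖(f n)⁻¹ y‖ ≤ 4 / (3 * ε) := by
    intro y hy
    rw [frontier_ball z hr0.ne'] at hy
    have h1 := hn y (hsub (Metric.sphere_subset_closedBall hy))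
    rw [dist_zero_right] at h1
    have h2 : ε ≤ ‖G y‖ := hmin hy
    have h3 : ‖G y‖ ≤ ‖f n y‖ + ‖f n y - G y‖ := by
      have := norm_sub_le (f n y) (f n y - G y)
      simpa using this
    have h4 : 3 * ε / 4 ≤ ‖f n y‖ := by linarith
    rw [Pi.inv_apply, norm_inv, inv_le_comm₀ (by linarith) (by positivity)]
    rw [inv_div]; exact h4
  have h5 := Complex.norm_le_of_forall_mem_frontier_norm_le Metric.isBounded_ball hinv hb
    (subset_closure (Metric.mem_ball_self hr0))
  have h6 := hn z (Metric.mem_closedBall_self zero_le_one)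
  rw [dist_zero_right] at h6
  rw [hz, sub_zero] at h6
  have h7 : 0 < ‖f n z‖ := norm_pos_iff.2 (hne z (Metric.mem_closedBall_self zero_le_one))
  rw [Pi.inv_apply, norm_inv, inv_le_comm₀ h7 (by positivity), inv_div] at h5
  linarith

theorem differentiableOn_eval {k : ℕ} {s : Set ℂ} (u : Fin k → ℂ → ℂ)
    (hu : ∀ i, DifferentiableOn ℂ (u i) s) (P : MvPolynomial (Fin k) ℂ) :
    DifferentiableOn ℂ (fun y => eval (fun i => u i y) P) s := by
  induction P using MvPolynomial.induction_on with
  | C a => simp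
  | add p q hp hq => simp only [map_add]; exact hp.add hq
  | mul_X p i hp => simp only [map_mul, eval_X]; exact hp.mul (hu i)

theorem differentiableOn_iterate_log {s : Set ℂ} {w : ℂ → ℂ} (hw : DifferentiableOn ℂ w s) (j : ℕ)
    (h : ∀ i < j, ∀ y ∈ s, Complex.log^[i] (w y) ∈ Complex.slitPlane) :
    DifferentiableOn ℂ (fun y => Complex.log^[j] (w y)) s := by
  induction j with
  | zero => simpa using hw
  | succ j ih =>
    simp only [Function.iterate_succ_apply']
    exact (ih fun i hi => h i (by omega)).clog (h j (by omega))

/-- A polynomial in `e^ζ` with two nonzero coefficients, one of them constant, has an isolated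
zero. -/
theorem exists_isolated_zero_eval_exp (g : Polynomial ℂ) (h0 : g.coeff 0 ≠ 0) {j : ℕ} (hj : j ≠ 0)
    (hgj : g.coeff j ≠ 0) :
    ∃ z : ℂ, ∃ r : ℝ, 0 < r ∧ r ≤ 1 ∧ g.eval (Complex.exp z) = 0 ∧
      ∀ y ∈ Metric.sphere z r, g.eval (Complex.exp y) ≠ 0 := by
  have hg : g ≠ 0 := fun h => h0 (by simp [h])
  have hdeg : 0 < g.degree := by
    rw [← Polynomial.natDegree_pos_iff_degree_pos]
    exact (Nat.pos_of_ne_zero hj).trans_le (Polynomial.le_natDegree_of_ne_zero hgj)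
  obtain ⟨x, hx⟩ := Complex.exists_root hdeg
  have hx0 : x ≠ 0 := by
    rintro rfl
    exact h0 (by rw [Polynomial.coeff_zero_eq_eval_zero]; exact hx)
  have han : AnalyticOnNhd ℂ (fun y => g.eval (Complex.exp y)) Set.univ :=
    (Differentiable.differentiableOn (by fun_prop)).analyticOnNhd isOpen_univ
  have hz : g.eval (Complex.exp (Complex.log x)) = 0 := by
    rw [Complex.exp_log hx0]; exact hx
  rcases (han (Complex.log x) (Set.mem_univ _)).eventually_eq_zero_or_eventually_ne_zero with h | h
  · exfalso
    have hzero := han.eq_of_eventuallyEq (g := fun _ => 0) analyticOnNhd_const h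
    refine hg (Polynomial.eq_zero_of_infinite_isRoot g ?_)
    refine Set.Infinite.mono (s := {0}ᶜ) (fun y hy => ?_) (Set.finite_singleton 0).infinite_compl
    have := congrFun hzero (Complex.log y)
    simpa [Complex.exp_log hy] using this
  · rw [eventually_nhdsWithin_iff, Metric.eventually_nhds_iff] at h
    obtain ⟨ε, hε, H⟩ := h
    refine ⟨Complex.log x, min (ε / 2) 1, by positivity, min_le_right _ _, hz, fun y hy => ?_⟩
    have hr : 0 < min (ε / 2) 1 := by positivity
    rw [Metric.mem_sphere] at hy
    refine H ?_ ?_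
    · rw [hy]; exact (min_le_left _ _).trans_lt (by linarith)
    · rintro rfl
      simp only [dist_self] at hy
      exact hr.ne hy

theorem tendsto_mul_mul_sub_zero {ι : Type} {F : Filter ι} {A B E : ι → ℂ} {a b : ℂ} {M : ℝ}
    (hA : Tendsto A F (𝓝 a)) (hB : Tendsto B F (𝓝 b)) (hE : ∀ᶠ x in F, ‖E x‖ ≤ M) :
    Tendsto (fun x => A x * B x * E x - a * b * E x) F (𝓝 0) := by
  have h1 : Tendsto (fun x => A x * B x - a * b) F (𝓝 0) := by
    simpa using (hA.mul hB).sub_const (a * b)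
  have := h1.zero_mul_isBoundedUnder_le (isBoundedUnder_of_eventually_le hE)
  refine this.congr fun x => by ring

theorem exists_iterate_log_eval_eq_zero {k : ℕ}
    (P : Polynomial (MvPolynomial (Fin (k + 1)) ℂ)) (h0 : P.coeff 0 ≠ 0) (hd : P.natDegree ≠ 0)
    (Q : MvPolynomial (Fin (k + 1)) ℂ) (hQ : Q ≠ 0) :
    ∃ w : ℂ, (∀ j : Fin (k + 1), Complex.log^[j.1] w ≠ 0) ∧
      (P.map (eval fun j : Fin (k + 1) => Complex.log^[j.1] w)).eval (Complex.exp w) = 0 ∧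
      eval (fun j : Fin (k + 1) => Complex.log^[j.1] w) Q ≠ 0 := by
  let c' : ℕ → ℂ := fun j => if j = 0 then Complex.I else 1
  have hc'sl : ∀ j, c' j ∈ Complex.slitPlane := by
    intro j
    by_cases hj : j = 0 <;> simp [c', hj, Complex.mem_slitPlane_iff]
  let c : Fin (k + 1) → ℂ := fun j => c' j
  have hc : ∀ j, c j ≠ 0 := fun j => Complex.slitPlane_ne_zero (hc'sl _)
  obtain ⟨mQ, CQ, hCQ, HQ⟩ := exists_tendsto_eval_div_monomial c hc Q hQ
  have IH : ∀ j, ∃ m : Fin (k + 1) → ℕ, ∃ C : ℂ, (P.coeff j ≠ 0 → C ≠ 0) ∧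
      (P.coeff j = 0 → C = 0) ∧ ∀ {ι : Type} (F : Filter ι) (r : Fin (k + 1) → ι → ℝ)
      (u : Fin (k + 1) → ι → ℂ), (∀ i, Tendsto (r i) F atTop) →
      (∀ i j, i < j → ∀ N : ℕ, Tendsto (fun n => r j n ^ N / r i n) F (𝓝 0)) →
      (∀ i, Tendsto (fun n => u i n / (r i n : ℂ)) F (𝓝 (c i))) →
      Tendsto (fun n => eval (fun i => u i n) (P.coeff j) / ((∏ i, r i n ^ m i : ℝ) : ℂ)) F
        (𝓝 C) := by
    intro j
    by_cases hj : P.coeff j = 0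
    · refine ⟨0, 0, fun h => (h hj).elim, fun _ => rfl, fun F r u _ _ _ => ?_⟩
      simpa [hj] using tendsto_const_nhds
    · obtain ⟨m, C, hC, H⟩ := exists_tendsto_eval_div_monomial c hc _ hj
      exact ⟨m, C, fun _ => hC, fun h => (hj h).elim, H⟩
  choose m C hC hC0 H using IH
  let T : ℕ → ℝ := fun n => 2 * Real.pi * n
  have hT : Tendsto T atTop atTop :=
    tendsto_natCast_atTop_atTop.const_mul_atTop (by positivity)
  let r : ℕ → ℕ → ℝ := fun j n => Real.log^[j] (T n)
  have hr : ∀ j, Tendsto (r j) atTop atTop := fun j => (tendsto_iterate_log_atTop j).comp hT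
  have hdom : ∀ i j, i < j → ∀ N : ℕ, Tendsto (fun n => r j n ^ N / r i n) atTop (𝓝 0) := by
    intro i j hij N
    refine ((tendsto_iterate_log_pow_div (j - i - 1) N).comp (hr i)).congr fun n => ?_
    simp only [Function.comp, r]
    rw [← Function.iterate_add_apply]
    congr 4; omega
  let ρ : ℕ → ℕ → ℝ := fun j n => ∏ i : Fin (k + 1), r i n ^ m j i
  have hrpos : ∀ᶠ n in atTop, ∀ i : Fin (k + 1), 0 < r i n :=
    eventually_all.2 fun i => (hr i).eventually_gt_atTop 0
  have hρpos : ∀ᶠ n in atTop, ∀ j, 0 < ρ j n := by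
    filter_upwards [hrpos] with n hn j
    exact Finset.prod_pos fun i _ => pow_pos (hn i) _
  have hlogr : ∀ i : ℕ, Tendsto (fun n => Real.log (r i n) / T n) atTop (𝓝 0) := by
    intro i
    have := hdom 0 (i + 1) (by omega) 1
    refine this.congr fun n => ?_
    simp [r, Function.iterate_succ_apply']
  have hlogρ : ∀ j, Tendsto (fun n => Real.log (ρ j n) / T n) atTop (𝓝 0) := by
    intro j
    have : Tendsto (fun n => ∑ i : Fin (k + 1), (m j i : ℝ) * (Real.log (r i n) / T n)) atTop
        (𝓝 (∑ i : Fin (k + 1), (m j i : ℝ) * 0)) :=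
      tendsto_finsetSum _ fun i _ => (hlogr i).const_mul _
    simp only [mul_zero, Finset.sum_const_zero] at this
    refine this.congr' ?_
    filter_upwards [hrpos] with n hn
    simp only [ρ]
    rw [Real.log_prod (fun i _ => pow_ne_zero _ (hn i).ne'), Finset.sum_div]
    exact Finset.sum_congr rfl fun i _ => by rw [Real.log_pow]; ring
  let J : Finset ℕ := P.support.erase 0
  have hJne : J.Nonempty := by
    refine ⟨P.natDegree, Finset.mem_erase.2 ⟨hd, Polynomial.natDegree_mem_support_of_nonzero ?_⟩⟩
    rintro rfl; simp at hd
  let σ : ℕ → ℕ → ℝ := fun j n => (Real.log (ρ 0 n) - Real.log (ρ j n)) / j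
  have hσ : ∀ j, Tendsto (fun n => σ j n / T n) atTop (𝓝 0) := by
    intro j
    have := ((hlogρ 0).sub (hlogρ j)).div_const (j : ℝ)
    simp only [sub_zero, zero_div] at this
    refine this.congr fun n => ?_
    simp only [σ]; ring
  let U : Ultrafilter ℕ := hyperfilter ℕ
  have hU : (U : Filter ℕ) ≤ atTop := Nat.hyperfilter_le_atTop
  obtain ⟨j₀, hj₀J, hj₀⟩ : ∃ j₀ ∈ J, ∀ᶠ n in (U : Filter ℕ), ∀ j ∈ J, σ j₀ n ≤ σ j n := by
    have : ∀ᶠ n in (U : Filter ℕ), ∃ j₀ ∈ (J : Set ℕ), ∀ j ∈ J, σ j₀ n ≤ σ j n :=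
      Eventually.of_forall fun n => J.exists_min_image (fun j => σ j n) hJne
    rwa [Ultrafilter.eventually_exists_mem_iff J.finite_toSet] at this
  have hJ0 : ∀ j ∈ J, (0 : ℝ) < j := fun j hj =>
    Nat.cast_pos.2 (Nat.pos_of_ne_zero (Finset.ne_of_mem_erase hj))
  let b : ℕ → ℕ → ℝ := fun j n => ρ j n * Real.exp (j * σ j₀ n) / ρ 0 n
  have hblim : ∀ j, ∃ l : ℝ, j ∈ J → Tendsto (b j) U (𝓝 l) := by
    intro j
    by_cases hj : j ∈ J
    swap
    · exact ⟨0, fun h => (hj h).elim⟩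
    have hmem : ∀ᶠ n in (U : Filter ℕ), b j n ∈ Set.Icc (0 : ℝ) 1 := by
      filter_upwards [hj₀, hU hρpos] with n hn hp
      refine ⟨div_nonneg (mul_nonneg (hp j).le (Real.exp_pos _).le) (hp 0).le, ?_⟩
      rw [div_le_one (hp 0)]
      have h1 : j * σ j₀ n ≤ Real.log (ρ 0 n) - Real.log (ρ j n) := by
        have := mul_le_mul_of_nonneg_left (hn j hj) (hJ0 j hj).le
        refine this.trans_eq ?_
        simp only [σ]; field_simp [(hJ0 j hj).ne']
      calc ρ j n * Real.exp (j * σ j₀ n)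
          ≤ ρ j n * Real.exp (Real.log (ρ 0 n) - Real.log (ρ j n)) :=
            mul_le_mul_of_nonneg_left (Real.exp_le_exp.2 h1) (hp j).le
        _ = ρ 0 n := by
            rw [Real.exp_sub, Real.exp_log (hp 0), Real.exp_log (hp j)]
            field_simp [(hp j).ne']
    obtain ⟨l, -, hl⟩ := isCompact_Icc.ultrafilter_le_nhds (U.map (b j))
      (le_principal_iff.2 hmem)
    exact ⟨l, fun _ => hl⟩
  choose l hl using hblim
  have hl₀ : l j₀ = 1 := by
    refine tendsto_nhds_unique (hl j₀ hj₀J) (tendsto_const_nhds.congr' ?_)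
    filter_upwards [hU hρpos] with n hp
    simp only [b, σ]
    rw [mul_div_cancel₀ _ (hJ0 j₀ hj₀J).ne', Real.exp_sub, Real.exp_log (hp 0),
      Real.exp_log (hp j₀)]
    field_simp [(hp j₀).ne', (hp 0).ne']
  let l' : ℕ → ℝ := fun j => if j = 0 then 1 else l j
  have hl' : ∀ j ∈ P.support, Tendsto (b j) U (𝓝 (l' j)) := by
    intro j hj
    by_cases hj0 : j = 0
    · subst hj0
      simp only [l', if_true]
      refine tendsto_const_nhds.congr' ?_
      filter_upwards [hU hρpos] with n hp
      simp [b, (hp 0).ne']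
    · simp only [l', hj0, if_false]
      exact hl j (Finset.mem_erase.2 ⟨hj0, hj⟩)
  let N := P.natDegree
  let g : Polynomial ℂ := ∑ j ∈ Finset.range (N + 1), Polynomial.monomial j (C j * l' j)
  have hgcoeff : ∀ j ∈ Finset.range (N + 1), g.coeff j = C j * l' j := by
    intro j hj
    simp only [g, Polynomial.finsetSum_coeff, Polynomial.coeff_monomial]
    rw [Finset.sum_ite_eq' (Finset.range (N + 1)) j, if_pos hj]
  have hj₀0 : j₀ ≠ 0 := Finset.ne_of_mem_erase hj₀J
  have hj₀s : P.coeff j₀ ≠ 0 := Polynomial.mem_support_iff.1 (Finset.mem_of_mem_erase hj₀J)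
  obtain ⟨z, R, hR0, hR1, hz, hsph⟩ := exists_isolated_zero_eval_exp g
    (by rw [hgcoeff 0 (by simp)]; simpa [l'] using hC 0 h0) hj₀0
    (by
      rw [hgcoeff j₀ (Finset.mem_range_succ_iff.2 (Polynomial.le_natDegree_of_ne_zero hj₀s))]
      simpa [l', hj₀0, hl₀] using hC j₀ hj₀s)
  let K := Metric.closedBall z 1
  let F : Filter (ℕ × ℂ) := (U : Filter ℕ) ×ˢ 𝓟 K
  have hF1 : Tendsto Prod.fst F atTop := tendsto_fst.mono_right hU
  let w : ℕ → ℂ → ℂ := fun n y => T n * Complex.I + σ j₀ n + y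
  have hK : ∀ᶠ x in F, x.2 ∈ K := eventually_prod_principal_iff.2
    (Eventually.of_forall fun n y hy => hy)
  have hw : Tendsto (fun x : ℕ × ℂ => w x.1 x.2 / (T x.1 : ℂ)) F (𝓝 Complex.I) := by
    have h1 : Tendsto (fun x : ℕ × ℂ => ((σ j₀ x.1 / T x.1 : ℝ) : ℂ)) F (𝓝 0) :=
      (Complex.continuous_ofReal.tendsto 0).comp ((hσ j₀).comp hF1)
    have h2 : Tendsto (fun x : ℕ × ℂ => ((T x.1)⁻¹ : ℂ) * x.2) F (𝓝 0) := by
      have h3 : Tendsto (fun x : ℕ × ℂ => ((T x.1)⁻¹ : ℂ)) F (𝓝 0) := by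
        have := (Complex.continuous_ofReal.tendsto 0).comp
          ((hT.comp hF1).inv_tendsto_atTop)
        refine this.congr fun x => by simp
      refine h3.zero_mul_isBoundedUnder_le (isBoundedUnder_of_eventually_le (a := ‖z‖ + 1) ?_)
      filter_upwards [hK] with x hx
      have : ‖x.2‖ ≤ ‖z‖ + ‖x.2 - z‖ := by
        simpa using norm_add_le z (x.2 - z)
      have h5 : ‖x.2 - z‖ ≤ 1 := by simpa [K, dist_eq_norm] using hx
      simp only [Function.comp]; linarith
    have h4 := (h1.add h2).const_add Complex.I
    simp only [add_zero] at h4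
    refine h4.congr' ?_
    filter_upwards [(hT.comp hF1).eventually_gt_atTop 0] with x hx
    have : (T x.1 : ℂ) ≠ 0 := Complex.ofReal_ne_zero.2 hx.ne'
    simp only [w]; push_cast; field_simp
    ring
  have hrF : ∀ j, Tendsto (fun x : ℕ × ℂ => r j x.1) F atTop := fun j => (hr j).comp hF1
  have hu : ∀ j, Tendsto (fun x : ℕ × ℂ => Complex.log^[j] (w x.1 x.2) / (r j x.1 : ℂ)) F
      (𝓝 (c' j)) := by
    intro j
    induction j with
    | zero => simpa [r, c'] using hw
    | succ j ih =>
      have := tendsto_log_div_log (hrF j) (hc'sl j) ih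
      simpa only [r, c', Function.iterate_succ_apply', Nat.succ_ne_zero, if_false] using this
  have hslit : ∀ᶠ x in F, ∀ j : Fin (k + 1), Complex.log^[j.1] (w x.1 x.2) ∈ Complex.slitPlane :=
    eventually_all.2 fun j => eventually_mem_slitPlane (hrF j) (hc'sl j) (hu j)
  have hdomF : ∀ i j : Fin (k + 1), i < j → ∀ N : ℕ,
      Tendsto (fun x : ℕ × ℂ => r j x.1 ^ N / r i x.1) F (𝓝 0) :=
    fun i j hij N => (hdom i j hij N).comp hF1
  have hQne : ∀ᶠ x in F, eval (fun j : Fin (k + 1) => Complex.log^[j.1] (w x.1 x.2)) Q ≠ 0 := by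
    have := HQ F (fun j x => r j x.1) (fun j x => Complex.log^[j.1] (w x.1 x.2))
      (fun j => hrF j) hdomF (fun j => hu j)
    filter_upwards [this.eventually_ne hCQ] with x hx h
    simp [h] at hx
  let f : ℕ → ℂ → ℂ := fun n y => ∑ j ∈ Finset.range (N + 1),
    eval (fun i : Fin (k + 1) => Complex.log^[i.1] (w n y)) (P.coeff j) *
      Complex.exp (w n y) ^ j / (ρ 0 n : ℂ)
  have hexp : ∀ n y, Complex.exp (w n y) = Real.exp (σ j₀ n) * Complex.exp y := by
    intro n y
    have : (T n : ℂ) * Complex.I = n * (2 * Real.pi * Complex.I) := by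
      simp only [T]; push_cast; ring
    simp only [w]
    rw [Complex.exp_add, Complex.exp_add, this, Complex.exp_nat_mul_two_pi_mul_I, one_mul,
      Complex.ofReal_exp]
  have hlim : Tendsto (fun x : ℕ × ℂ => f x.1 x.2 - g.eval (Complex.exp x.2)) F (𝓝 0) := by
    have hterm : ∀ j ∈ Finset.range (N + 1), Tendsto (fun x : ℕ × ℂ =>
        eval (fun i : Fin (k + 1) => Complex.log^[i.1] (w x.1 x.2)) (P.coeff j) *
        Complex.exp (w x.1 x.2) ^ j / (ρ 0 x.1 : ℂ) - C j * l' j * Complex.exp x.2 ^ j) F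
        (𝓝 0) := by
      intro j hj
      by_cases hcj : P.coeff j = 0
      · simpa [hcj, hC0 j hcj] using tendsto_const_nhds
      have hA := H j F (fun j x => r j x.1) (fun j x => Complex.log^[j.1] (w x.1 x.2))
        (fun j => hrF j) hdomF (fun j => hu j)
      have hB : Tendsto (fun x : ℕ × ℂ => ((b j x.1 : ℝ) : ℂ)) F (𝓝 (l' j : ℂ)) :=
        (Complex.continuous_ofReal.tendsto _).comp
          ((hl' j (Polynomial.mem_support_iff.2 hcj)).comp tendsto_fst)
      obtain ⟨M, hM⟩ := (isCompact_closedBall z 1).exists_bound_of_continuousOn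
        (f := fun y => Complex.exp y ^ j) (by fun_prop)
      have hE : ∀ᶠ x : ℕ × ℂ in F, ‖Complex.exp x.2 ^ j‖ ≤ M := by
        filter_upwards [hK] with x hx using hM _ hx
      refine (tendsto_mul_mul_sub_zero hA hB hE).congr' ?_
      filter_upwards [hF1.eventually hρpos] with x hp
      have h1 : ((ρ j x.1 : ℝ) : ℂ) ≠ 0 := Complex.ofReal_ne_zero.2 (hp j).ne'
      have h2 : ((ρ 0 x.1 : ℝ) : ℂ) ≠ 0 := Complex.ofReal_ne_zero.2 (hp 0).ne'
      have h3 : ((∏ i : Fin (k + 1), r i x.1 ^ m j i : ℝ) : ℂ) = ((ρ j x.1 : ℝ) : ℂ) := rfl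
      rw [h3, hexp, mul_pow]
      simp only [b]
      rw [Real.exp_nat_mul]
      push_cast
      field_simp
    have := tendsto_finsetSum _ hterm
    simp only [Finset.sum_const_zero] at this
    refine this.congr fun x => ?_
    simp only [f, g, Polynomial.eval_finsetSum, Polynomial.eval_monomial, Finset.sum_sub_distrib]
  have hdiff : ∀ᶠ n in (U : Filter ℕ), DifferentiableOn ℂ (f n) K := by
    filter_upwards [eventually_prod_principal_iff.1 hslit] with n hn
    have hwd : DifferentiableOn ℂ (w n) K := by
      simp only [w]; fun_prop
    refine DifferentiableOn.fun_sum fun j _ => ?_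
    refine DifferentiableOn.div_const (DifferentiableOn.mul ?_ (hwd.cexp.pow j)) _
    refine differentiableOn_eval (fun (i : Fin (k + 1)) y => Complex.log^[i.1] (w n y))
      (fun i => ?_) _
    exact differentiableOn_iterate_log hwd _ fun j hj y hy =>
      hn y hy ⟨j, hj.trans i.2⟩
  have hzero := exists_zero_of_tendsto_sub (F := (U : Filter ℕ)) (f := f)
    (G := fun y => g.eval (Complex.exp y)) hR0 hR1 (by fun_prop) hz hsph hlim hdiff
  obtain ⟨n, ⟨y, hy, hfy⟩, hs, hq, hp⟩ := (hzero.and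
    ((eventually_prod_principal_iff.1 hslit).and
      ((eventually_prod_principal_iff.1 hQne).and (hU hρpos)))).exists
  refine ⟨w n y, fun j => Complex.slitPlane_ne_zero (hs y hy j), ?_, hq y hy⟩
  have h2 : ((ρ 0 n : ℝ) : ℂ) ≠ 0 := Complex.ofReal_ne_zero.2 (hp 0).ne'
  simp only [f] at hfy
  rw [← Finset.sum_div, div_eq_zero_iff, or_iff_left h2] at hfy
  rw [Polynomial.eval_map, Polynomial.eval₂_eq_sum_range]
  exact hfy

/-- The isomorphism `ℂ[x₀,…,xₙ] ≃ ℂ[x₀,…,xₙ₋₁][X]` sending the last variable to `X`. -/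
noncomputable def lastVarEquiv (n : ℕ) :
    MvPolynomial (Fin (n + 1)) ℂ ≃ₐ[ℂ] Polynomial (MvPolynomial (Fin n) ℂ) :=
  (renameEquiv ℂ Fin.revPerm).trans
    ((finSuccEquiv ℂ n).trans (Polynomial.mapAlgEquiv (renameEquiv ℂ Fin.revPerm)))

theorem lastVarEquiv_apply {n : ℕ} (p : MvPolynomial (Fin (n + 1)) ℂ) :
    lastVarEquiv n p =
      (finSuccEquiv ℂ n (rename Fin.rev p)).map (rename (R := ℂ) (Fin.rev (n := n))).toRingHom := by
  rfl

theorem lastVarEquiv_X_last {n : ℕ} : lastVarEquiv n (X (Fin.last n)) = Polynomial.X := by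
  simp [lastVarEquiv_apply, finSuccEquiv_X_zero]

theorem lastVarEquiv_X_castSucc {n : ℕ} (i : Fin n) :
    lastVarEquiv n (X i.castSucc) = Polynomial.C (X i) := by
  simp [lastVarEquiv_apply, Fin.rev_castSucc, finSuccEquiv_X_succ]

theorem natDegree_lastVarEquiv {n : ℕ} (p : MvPolynomial (Fin (n + 1)) ℂ) :
    (lastVarEquiv n p).natDegree = degreeOf (Fin.last n) p := by
  rw [lastVarEquiv_apply, Polynomial.natDegree_map_eq_of_injective
    (rename_injective _ Fin.rev_injective), natDegree_finSuccEquiv,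
    ← degreeOf_rename_of_injective (p := p) Fin.rev_injective, Fin.rev_last]

theorem eval_map_lastVarEquiv {n : ℕ} (p : MvPolynomial (Fin (n + 1)) ℂ) (x : Fin (n + 1) → ℂ) :
    ((lastVarEquiv n p).map (eval (x ∘ Fin.castSucc))).eval (x (Fin.last n)) = eval x p := by
  have : (((Polynomial.evalRingHom (x (Fin.last n))).comp
      (Polynomial.mapRingHom (eval (x ∘ Fin.castSucc)))).comp
      (lastVarEquiv n : MvPolynomial (Fin (n + 1)) ℂ →+* _)) = eval x := by
    ext i
    · have : lastVarEquiv n (C i) = Polynomial.C (C i) := (lastVarEquiv n).commutes i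
      simp [this]
    · induction i using Fin.lastCases with
      | last => simp [lastVarEquiv_X_last]
      | cast i => simp [lastVarEquiv_X_castSucc]
  simpa using RingHom.congr_fun this p

theorem lastVarEquiv_coeff_zero_ne_zero {n : ℕ} {p : MvPolynomial (Fin (n + 1)) ℂ}
    (hp : Irreducible p) {i : Fin n} (hi : degreeOf i.castSucc p ≠ 0) :
    (lastVarEquiv n p).coeff 0 ≠ 0 := by
  intro h
  obtain ⟨q, hq⟩ := Polynomial.X_dvd_iff.2 h
  rw [← lastVarEquiv_X_last] at hq
  have hdvd : X (Fin.last n) ∣ p := by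
    refine ⟨(lastVarEquiv n).symm q, (lastVarEquiv n).injective ?_⟩
    rw [hq, map_mul, AlgEquiv.apply_symm_apply]
  obtain ⟨u, hu⟩ := (X_prime (R := ℂ) (i := Fin.last n)).irreducible.associated_of_dvd hp hdvd
  obtain ⟨c, hc, hc'⟩ := (isUnit_iff_eq_C_of_isReduced).1 u.isUnit
  apply hi
  rw [← hu, hc', mul_comm, degreeOf_C_mul _ _ (mem_nonZeroDivisors_of_ne_zero hc.ne_zero), degreeOf_X_of_ne]
  exact (Fin.castSucc_lt_last i).ne

theorem finSuccEquiv_coeff_zero_ne_zero {n : ℕ} {p : MvPolynomial (Fin (n + 1)) ℂ}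
    (hp : Irreducible p) {i : Fin (n + 1)} (hi' : i ≠ 0) (hi : degreeOf i p ≠ 0) :
    (finSuccEquiv ℂ n p).coeff 0 ≠ 0 := by
  intro h
  obtain ⟨q, hq⟩ := Polynomial.X_dvd_iff.2 h
  rw [← finSuccEquiv_X_zero] at hq
  have hdvd : X 0 ∣ p := by
    refine ⟨(finSuccEquiv ℂ n).symm q, (finSuccEquiv ℂ n).injective ?_⟩
    rw [hq, map_mul, AlgEquiv.apply_symm_apply]
  obtain ⟨u, hu⟩ := (X_prime (R := ℂ) (i := (0 : Fin (n + 1)))).irreducible.associated_of_dvd hp hdvd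
  obtain ⟨c, hc, hc'⟩ := (isUnit_iff_eq_C_of_isReduced).1 u.isUnit
  apply hi
  rw [← hu, hc', mul_comm, degreeOf_C_mul _ _ (mem_nonZeroDivisors_of_ne_zero hc.ne_zero), degreeOf_X_of_ne]
  exact hi'

theorem iterExp_iterate_log {n : ℕ} {w : ℂ} (h : ∀ j ≤ n, Complex.log^[j] w ≠ 0) :
    ∀ i ≤ n + 1, iterExp i (Complex.log^[n + 1] w) = Complex.log^[n + 1 - i] w := by
  intro i hi
  induction i with
  | zero => rfl
  | succ i ih =>
    obtain ⟨m, rfl⟩ : ∃ m, n = i + m := ⟨n - i, by omega⟩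
    rw [iterExp, ih (by omega), show i + m + 1 - i = m + 1 by omega,
      show i + m + 1 - (i + 1) = m by omega, Function.iterate_succ_apply',
      Complex.exp_log (h m (by omega))]

theorem exists_iterExp_zero_avoiding {k : ℕ} (p : MvPolynomial (Fin (k + 2)) ℂ)
    (h0 : (lastVarEquiv (k + 1) p).coeff 0 ≠ 0) (hd : degreeOf (Fin.last (k + 1)) p ≠ 0)
    (Q : MvPolynomial (Fin (k + 1)) ℂ) (hQ : Q ≠ 0) :
    ∃ a : ℂ, eval (fun i : Fin (k + 2) => iterExp i.1 a) p = 0 ∧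
      eval (fun i : Fin (k + 1) => iterExp i.1 a) Q ≠ 0 := by
  have hinj : Function.Injective (rename (R := ℂ) (Fin.rev (n := k + 1))) :=
    rename_injective _ Fin.rev_injective
  obtain ⟨w, hw, hp, hQ⟩ := exists_iterate_log_eval_eq_zero
    ((lastVarEquiv (k + 1) p).map (rename (R := ℂ) (Fin.rev (n := k + 1))).toRingHom)
    (by rw [Polynomial.coeff_map]; exact (map_ne_zero_iff _ hinj).2 h0)
    (by rwa [Polynomial.natDegree_map_eq_of_injective hinj, natDegree_lastVarEquiv])
    (rename Fin.rev Q) ((map_ne_zero_iff _ hinj).2 hQ)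
  have hx : ∀ i : Fin (k + 1), iterExp i.1 (Complex.log^[k] w) = Complex.log^[k - i.1] w := by
    intro i
    rcases k with _ | k
    · fin_cases i
      rfl
    · exact iterExp_iterate_log (fun j hj => hw ⟨j, by omega⟩) i.1 (by omega)
  have hx' : (fun j : Fin (k + 1) => Complex.log^[j.1] w) ∘ Fin.rev =
      fun i : Fin (k + 1) => iterExp i.1 (Complex.log^[k] w) := by
    funext i
    rw [hx, Function.comp_apply, Fin.val_rev, Nat.add_sub_add_right]
  refine ⟨Complex.log^[k] w, ?_, ?_⟩
  · rw [← eval_map_lastVarEquiv]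
    have h1 : iterExp (k + 1) (Complex.log^[k] w) = Complex.exp w := by
      rw [iterExp]
      have := hx (Fin.last k)
      simp only [Fin.val_last, Nat.sub_self, Function.iterate_zero, id] at this
      rw [this]
    rw [Polynomial.map_map] at hp
    simp only [Fin.val_last]
    rw [h1]
    convert hp using 3
    ext i
    · simp
    · simp [hx]
  · rwa [eval_rename, hx'] at hQ

open scoped nonZeroDivisors in
theorem Polynomial.exists_C_eq_mul_add_mul_of_irreducible {R : Type*} [CommRing R] [IsDomain R]
    [UniqueFactorizationMonoid R] {P q : Polynomial R} (hP : Irreducible P)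
    (hd : P.natDegree ≠ 0) (hq : ¬ P ∣ q) :
    ∃ c : R, c ≠ 0 ∧ ∃ U V : Polynomial R, Polynomial.C c = U * P + V * q := by
  classical
  let := UniqueFactorizationMonoid.strongNormalizationMonoid (α := R)
  let := UniqueFactorizationMonoid.toNormalizedGCDMonoid R
  have hprim := hP.isPrimitive hd
  have hirr : Irreducible (P.map (algebraMap R (FractionRing R))) :=
    (hprim.irreducible_iff_irreducible_map_fraction_map (K := FractionRing R)).1 hP
  have hndvd : ¬ P.map (algebraMap R (FractionRing R)) ∣ q.map (algebraMap R (FractionRing R)) :=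
    fun h => hq ((hprim.dvd_iff_fraction_map_dvd_fraction_map (FractionRing R)).2 h)
  obtain ⟨u, v, huv⟩ := (hirr.coprime_iff_not_dvd).2 hndvd
  obtain ⟨b, hb, hbu⟩ := IsLocalization.integerNormalization_spec R⁰ u
  obtain ⟨b', hb', hbv⟩ := IsLocalization.integerNormalization_spec R⁰ v
  refine ⟨b * b', mul_ne_zero (nonZeroDivisors.ne_zero hb) (nonZeroDivisors.ne_zero hb'),
    Polynomial.C b' * IsLocalization.integerNormalization R⁰ u,
    Polynomial.C b * IsLocalization.integerNormalization R⁰ v,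
    Polynomial.map_injective _ (IsFractionRing.injective R (FractionRing R)) ?_⟩
  simp only [Polynomial.map_add, Polynomial.map_mul, Polynomial.map_C, hbu, hbv, map_mul,
    Algebra.smul_def, IsScalarTower.algebraMap_apply R (FractionRing R) (Polynomial (FractionRing R)),
    Polynomial.algebraMap_eq]
  linear_combination -(Polynomial.C (algebraMap R (FractionRing R) b) *
    Polynomial.C (algebraMap R (FractionRing R) b')) * huv

theorem exists_eliminant {n : ℕ} {p : MvPolynomial (Fin (n + 2)) ℂ} (hp : Irreducible p)
    (h0 : degreeOf 0 p ≠ 0) (hl : degreeOf (Fin.last (n + 1)) p ≠ 0) :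
    ∃ Q : MvPolynomial (Fin (n + 1)) ℂ, Q ≠ 0 ∧ ∀ x : Fin (n + 2) → ℂ, eval x p = 0 →
      eval (Function.update x 0 0) p = 0 → eval (x ∘ Fin.castSucc) Q = 0 := by
  set q : MvPolynomial (Fin (n + 2)) ℂ := rename Fin.succ ((finSuccEquiv ℂ (n + 1) p).coeff 0)
    with hq
  have hq0 : q ≠ 0 := (map_ne_zero_iff _ (rename_injective _ (Fin.succ_injective _))).2
    (finSuccEquiv_coeff_zero_ne_zero hp (Fin.last_pos.ne') hl)
  have hqe : ∀ x : Fin (n + 2) → ℂ, eval x q = eval (Function.update x 0 0) p := by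
    intro x
    have h1 : Function.update x 0 0 = Fin.cons 0 (x ∘ Fin.succ) := by
      funext i
      refine Fin.cases ?_ (fun i => ?_) i <;> simp [Fin.succ_ne_zero]
    rw [h1, eval_eq_eval_mv_eval', hq, eval_rename, ← Polynomial.coeff_zero_eq_eval_zero,
      Polynomial.coeff_map]
  have hqd : degreeOf 0 q = 0 := by
    rw [← natDegree_finSuccEquiv]
    have : finSuccEquiv ℂ (n + 1) q = Polynomial.C ((finSuccEquiv ℂ (n + 1) p).coeff 0) := by
      rw [hq]
      induction (finSuccEquiv ℂ (n + 1) p).coeff 0 using MvPolynomial.induction_on with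
      | C a => simpa using (finSuccEquiv ℂ (n + 1)).commutes a
      | add f g hf hg => simp [hf, hg]
      | mul_X f i hf => simp [hf, finSuccEquiv_X_succ]
    rw [this, Polynomial.natDegree_C]
  have hndvd : ¬ p ∣ q := by
    rintro ⟨r, hr⟩
    have : r ≠ 0 := by rintro rfl; exact hq0 (by rw [hr, mul_zero])
    rw [hr, degreeOf_mul_eq hp.ne_zero this] at hqd
    omega
  have hirr : Irreducible (lastVarEquiv (n + 1) p) :=
    (MulEquiv.irreducible_iff (lastVarEquiv (n + 1))).2 hp
  obtain ⟨c, hc, U, V, hUV⟩ := Polynomial.exists_C_eq_mul_add_mul_of_irreducible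
    (q := lastVarEquiv (n + 1) q) hirr
    (by rwa [natDegree_lastVarEquiv]) (fun h => hndvd ((map_dvd_iff (lastVarEquiv (n + 1))).1 h))
  refine ⟨c, hc, fun x hx hx' => ?_⟩
  have := congrArg (fun f => (f.map (eval (x ∘ Fin.castSucc))).eval (x (Fin.last (n + 1)))) hUV
  simpa [eval_map_lastVarEquiv, hx, hqe, hx'] using this

/-- The matroid of algebraic independence over `ℚ` on `ℂ`. -/
noncomputable abbrev algIndepMatroid : Matroid ℂ := AlgebraicIndependent.matroid ℚ ℂ

/-- The relative algebraic closure of `ℚ(S)` in `ℂ`. -/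
noncomputable def acl (S : Set ℂ) : Subalgebra ℚ ℂ :=
  (Subalgebra.algebraicClosure (Algebra.adjoin ℚ S) ℂ).restrictScalars ℚ

theorem coe_acl (S : Set ℂ) : (acl S : Set ℂ) = algIndepMatroid.closure S :=
  (AlgebraicIndependent.matroid_closure_eq (R := ℚ) (A := ℂ)).symm

theorem mem_acl_of_isAlgebraic {S : Set ℂ} {z : ℂ} (h : IsAlgebraic (acl S) z) : z ∈ acl S := by
  obtain ⟨T, hT, hz⟩ := AlgebraicIndependent.matroid_isFlat_iff.1
    (algIndepMatroid.isFlat_closure S)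
  have : T = acl S := SetLike.coe_injective (by rw [hT, coe_acl])
  subst this
  rw [← SetLike.mem_coe, hT]
  exact hz z h

theorem subset_acl (S : Set ℂ) : S ⊆ acl S := by
  rw [coe_acl]
  exact algIndepMatroid.subset_closure S

theorem mem_acl_of_isAlgebraic_rat {S : Set ℂ} {z : ℂ} (h : IsAlgebraic ℚ z) : z ∈ acl S :=
  mem_acl_of_isAlgebraic (h.extendScalars (algebraMap ℚ (acl S)).injective)

theorem inv_mem_acl {S : Set ℂ} {z : ℂ} (h : z ∈ acl S) : z⁻¹ ∈ acl S :=
  mem_acl_of_isAlgebraic (IsAlgebraic.inv (isAlgebraic_algebraMap (⟨z, h⟩ : acl S)))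

theorem zpow_mem_acl {S : Set ℂ} {z : ℂ} (h : z ∈ acl S) (n : ℤ) : z ^ n ∈ acl S := by
  cases n with
  | ofNat n => simpa using pow_mem h n
  | negSucc n => simpa using inv_mem_acl (pow_mem h (n + 1))

theorem mem_acl_of_pow_mem {S : Set ℂ} {z : ℂ} {n : ℕ} (hn : n ≠ 0) (h : z ^ n ∈ acl S) :
    z ∈ acl S :=
  mem_acl_of_isAlgebraic
    ((isAlgebraic_algebraMap (⟨z ^ n, h⟩ : acl S)).of_pow (Nat.pos_of_ne_zero hn))

theorem mem_acl_of_zpow_mem {S : Set ℂ} {z : ℂ} {n : ℤ} (hn : n ≠ 0) (h : z ^ n ∈ acl S) :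
    z ∈ acl S := by
  refine mem_acl_of_pow_mem (n := n.natAbs) (by simpa using hn) ?_
  rcases Int.natAbs_eq n with h' | h'
  · rwa [h', zpow_natCast] at h
  · rw [h', zpow_neg, zpow_natCast] at h
    simpa using inv_mem_acl h

theorem mem_acl_of_mul_mem {S : Set ℂ} {z w : ℂ} (hw : w ∈ acl S) (hw0 : w ≠ 0)
    (h : w * z ∈ acl S) : z ∈ acl S := by
  simpa [hw0] using mul_mem (inv_mem_acl hw) h

theorem eRk_le_of_subset_acl {S T : Set ℂ} (h : S ⊆ acl T) :
    algIndepMatroid.eRk S ≤ algIndepMatroid.eRk T := by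
  rw [coe_acl] at h
  rw [← algIndepMatroid.eRk_closure_eq T]
  exact algIndepMatroid.eRk_mono h

theorem le_eRk_of_algebraicIndependent {S : Set ℂ} {n : ℕ} {f : Fin n → ℂ} (hf : ∀ i, f i ∈ S)
    (h : AlgebraicIndependent ℚ f) : (n : ℕ∞) ≤ algIndepMatroid.eRk S := by
  have h1 : algIndepMatroid.Indep (Set.range f) := by
    rw [AlgebraicIndependent.matroid_indep_iff]
    exact h.coe_range
  have := h1.encard_le_eRk_of_subset (X := S) (Set.range_subset_iff.2 hf)
  rwa [← Set.image_univ, h.injective.encard_image, Set.encard_univ, ENat.card_eq_coe_fintype_card, Fintype.card_fin] at this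

theorem hasTrdeg_of_eRk_eq {S : Set ℂ} {d : ℕ} (h : algIndepMatroid.eRk S = d) : HasTrdeg S d := by
  constructor
  · obtain ⟨I, hI⟩ := algIndepMatroid.exists_isBasis S
    have hc : I.encard = d := by rw [hI.encard_eq_eRk, h]
    have hfin : I.Finite := Set.finite_of_encard_eq_coe hc
    have hcard : Nat.card I = d := by
      have := hfin.cast_ncard_eq
      rw [hc] at this
      exact_mod_cast this
    have : Finite I := hfin
    let e := (Finite.equivFinOfCardEq hcard).symm
    refine ⟨fun i => e i, fun i => hI.subset (e i).2, ?_⟩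
    have := AlgebraicIndependent.matroid_indep_iff.1 hI.indep
    exact AlgebraicIndependent.comp this e e.injective
  · intro e g hg hi
    have := le_eRk_of_algebraicIndependent hg hi
    rw [h] at this
    exact_mod_cast this

theorem SchanuelConjecture.le_eRk (hSC : SchanuelConjecture) {n : ℕ} {l : Fin n → ℂ}
    (hl : LinearIndependent ℚ l) {S : Set ℂ} (h : ∀ i, l i ∈ S) (h' : ∀ i, Complex.exp (l i) ∈ S) :
    (n : ℕ∞) ≤ algIndepMatroid.eRk S := by
  obtain ⟨f, hf, hi⟩ := hSC n l hl
  refine le_eRk_of_algebraicIndependent (fun i => ?_) hi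
  rcases hf i with ⟨j, hj⟩ | ⟨j, hj⟩
  · exact hj ▸ h j
  · exact hj ▸ h' j

theorem exists_map_algebraMap_acl_eq {σ : Type*} {S : Set ℂ} {p : MvPolynomial σ ℂ}
    (hp : ∀ m, coeff m p ∈ acl S) :
    ∃ p' : MvPolynomial σ (acl S), map (algebraMap (acl S) ℂ) p' = p := by
  refine mem_range_map_iff_coeffs_subset.2 fun c hc => ?_
  obtain ⟨m, -, rfl⟩ := mem_coeffs_iff.1 hc
  exact ⟨⟨_, hp m⟩, rfl⟩

/-- A polynomial over an algebraically closed subfield that vanishes at a point exactly one of whose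
coordinates lies outside that subfield vanishes on a whole line. -/
theorem eval_update_eq_zero_of_not_mem_acl {σ : Type*} [DecidableEq σ] {S : Set ℂ}
    {p : MvPolynomial σ ℂ} (hp : ∀ m, coeff m p ∈ acl S) {v : σ → ℂ} {i : σ}
    (hv : ∀ j ≠ i, v j ∈ acl S) (hi : v i ∉ acl S) (h : eval v p = 0) (z : ℂ) :
    eval (Function.update v i z) p = 0 := by
  obtain ⟨p, rfl⟩ := exists_map_algebraMap_acl_eq hp
  let w : σ → Polynomial (acl S) := fun j =>
    if hj : j = i then Polynomial.X else Polynomial.C ⟨v j, hv j hj⟩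
  have hw : ∀ z, Polynomial.aeval z (aeval w p) = eval (Function.update v i z)
      (map (algebraMap (acl S) ℂ) p) := by
    intro z
    have : (fun j => Polynomial.aeval z (w j)) = Function.update v i z := by
      funext j
      by_cases hj : j = i
      · subst hj; simp [w]
      · simp [w, hj, Function.update_of_ne]
    rw [eval_map, ← this, ← AlgHom.comp_apply, comp_aeval]
    rfl
  have h0 : aeval w p = 0 := by
    by_contra hne
    refine hi (mem_acl_of_isAlgebraic ⟨aeval w p, hne, ?_⟩)
    rw [hw, Function.update_eq_self, h]
  rw [← hw, h0, map_zero]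

theorem totalDegree_aeval_le {σ τ R : Type*} [CommRing R] {w : σ → MvPolynomial τ R}
    (hw : ∀ j, (w j).totalDegree ≤ 1) (p : MvPolynomial σ R) :
    (aeval w p).totalDegree ≤ p.totalDegree := by
  rw [aeval_def, eval₂_eq]
  refine totalDegree_finsetSum_le fun d hd => (totalDegree_mul _ _).trans ?_
  rw [algebraMap_eq, totalDegree_C, zero_add]
  refine (totalDegree_finsetProd _ _).trans ((Finset.sum_le_sum fun i _ => ?_).trans
    (le_totalDegree hd))
  exact (totalDegree_pow _ _).trans (by simpa using Nat.mul_le_mul_left (d i) (hw i))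

theorem exists_slope_of_zpow_mul_zpow_mem_acl {S : Set ℂ} {Θ : MvPolynomial (Fin 2) (acl S)}
    (hΘ : Θ ≠ 0) {x y : ℂ} (hx : x ∉ acl S) (hy0 : y ≠ 0) (h : aeval ![x, y] Θ = 0)
    {M : ℕ} (hM : M ≠ 0) {m : ℤ} (hm : y ^ M * x ^ m ∈ acl S) :
    ∃ s ∈ Θ.support, ∃ s' ∈ Θ.support, s 1 ≠ s' 1 ∧
      (m : ℚ) / M = ((s 0 : ℚ) - s' 0) / ((s 1 : ℚ) - s' 1) := by
  obtain ⟨t, ht⟩ := IsAlgClosed.exists_pow_nat_eq x (Nat.pos_of_ne_zero hM)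
  have htS : t ∉ acl S := fun h' => hx (ht ▸ pow_mem h' M)
  have ht0 : t ≠ 0 := fun h' => htS (h' ▸ zero_mem _)
  have hc : y * t ^ m ∈ acl S := by
    refine mem_acl_of_pow_mem hM ?_
    rwa [mul_pow, ← zpow_natCast, ← zpow_natCast, ← zpow_mul, mul_comm m, zpow_mul, zpow_natCast,
      zpow_natCast, ht]
  set c : acl S := ⟨y * t ^ m, hc⟩
  have hy : y = c * t ^ (-m) := by
    rw [zpow_neg, mul_assoc, mul_inv_cancel₀ (zpow_ne_zero _ ht0), mul_one]
  have hc0 : c ≠ 0 := fun h' => mul_ne_zero hy0 (zpow_ne_zero m ht0) (congrArg Subtype.val h')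
  let e : (Fin 2 →₀ ℕ) → ℤ := fun s => M * s 0 - m * s 1
  by_cases hinj : Set.InjOn e Θ.support
  · exfalso
    obtain ⟨N, hN⟩ : ∃ N : ℕ, ∀ s ∈ Θ.support, 0 ≤ e s + N := by
      refine ⟨∑ s ∈ Θ.support, (e s).natAbs, fun s hs => ?_⟩
      have h1 : (e s).natAbs ≤ ∑ s ∈ Θ.support, (e s).natAbs :=
        Finset.single_le_sum (f := fun s => (e s).natAbs) (fun _ _ => Nat.zero_le _) hs
      omega
    let P : Polynomial (acl S) :=
      ∑ s ∈ Θ.support, Polynomial.monomial (e s + N).toNat (coeff s Θ * c ^ s 1)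
    have hP : P ≠ 0 := by
      obtain ⟨s, hs⟩ := support_nonempty.2 hΘ
      intro hP
      have := congrArg (Polynomial.coeff · (e s + N).toNat) hP
      simp only [P, Polynomial.finsetSum_coeff, Polynomial.coeff_monomial,
        Polynomial.coeff_zero] at this
      rw [Finset.sum_eq_single_of_mem s hs, if_pos rfl] at this
      · exact mul_ne_zero (mem_support_iff.1 hs) (pow_ne_zero _ hc0) this
      · intro s' hs' hne
        refine if_neg fun h' => hne (hinj hs' hs ?_)
        have h1 := hN s hs
        have h2 := hN s' hs'
        omega
    refine htS (mem_acl_of_isAlgebraic ⟨P, hP, ?_⟩)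
    rw [aeval_def, eval₂_eq'] at h
    suffices Polynomial.aeval t P = t ^ N * ∑ d ∈ Θ.support,
        (algebraMap (acl S) ℂ) (coeff d Θ) * ∏ i, ![x, y] i ^ d i by rw [this, h, mul_zero]
    simp only [P, map_sum, Polynomial.aeval_monomial, Finset.mul_sum]
    refine Finset.sum_congr rfl fun s hs => ?_
    have h1 : (t : ℂ) ^ (e s + N).toNat = t ^ N * (t ^ M) ^ s 0 * (t ^ (-m)) ^ s 1 := by
      rw [← zpow_natCast, Int.toNat_of_nonneg (hN s hs), zpow_add₀ ht0]
      simp only [e]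
      rw [sub_eq_add_neg, zpow_add₀ ht0, ← pow_mul, ← zpow_natCast, ← zpow_natCast, ← zpow_natCast,
        ← zpow_mul]
      push_cast
      ring_nf
    rw [h1, Fin.prod_univ_two]
    simp only [Matrix.cons_val_zero, Matrix.cons_val_one, map_mul, map_pow]
    rw [hy, ← ht]
    change _ * (c : ℂ) ^ _ * _ = _
    ring
  · simp only [Set.InjOn, not_forall] at hinj
    obtain ⟨s, hs, s', hs', he, hne⟩ := hinj
    have he' : (M : ℤ) * (s 0 - s' 0) = m * (s 1 - s' 1) := by
      simp only [e] at he
      linarith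
    have h1 : s 1 ≠ s' 1 := by
      intro h1
      apply hne
      rw [h1, sub_self, mul_zero, mul_eq_zero, or_iff_right (by exact_mod_cast hM)] at he'
      ext i
      fin_cases i
      · simpa [sub_eq_zero] using he'
      · exact h1
    refine ⟨s, hs, s', hs', h1, ?_⟩
    have h2 : (s 1 : ℚ) - s' 1 ≠ 0 := sub_ne_zero.2 (by exact_mod_cast h1)
    rw [div_eq_div_iff (by exact_mod_cast hM) h2]
    have : ((M : ℤ) * (s 0 - s' 0) : ℚ) = m * (s 1 - s' 1) := by exact_mod_cast he'
    push_cast at this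
    linarith

/-- The finite set of fractions `(a - b) / (c - d)` with natural numbers `a, b, c, d ≤ D`. -/
noncomputable def slopes (D : ℕ) : Finset ℚ :=
  ((Finset.range (D + 1) ×ˢ Finset.range (D + 1)) ×ˢ
    (Finset.range (D + 1) ×ˢ Finset.range (D + 1))).image
    fun q => ((q.1.1 : ℚ) - q.1.2) / ((q.2.1 : ℚ) - q.2.2)

theorem div_mem_slopes {n : ℕ} {S : Set ℂ} {p : MvPolynomial (Fin (n + 1)) ℂ}
    (hp : ∀ m, coeff m p ∈ acl S) {x : Fin (n + 1) → ℂ} {i : Fin (n + 1)} (hi0 : i ≠ 0)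
    (hil : i ≠ Fin.last n) (hS : ∀ j, j ≠ 0 → j ≠ i → j ≠ Fin.last n → x j ∈ acl S)
    (hxi : x i ∉ acl S) {α β : ℂ} (hα : α ∈ acl S) (hβ : β ∈ acl S) (h0 : x 0 = α * x i + β)
    (hl : x (Fin.last n) ≠ 0) (h : eval x p = 0)
    (h' : eval (Function.update x (Fin.last n) 0) p ≠ 0) {M : ℕ} (hM : M ≠ 0) {m : ℤ}
    (hm : x (Fin.last n) ^ M * x i ^ m ∈ acl S) :
    (m : ℚ) / M ∈ slopes p.totalDegree := by
  obtain ⟨p, rfl⟩ := exists_map_algebraMap_acl_eq hp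
  have hl0 : (0 : Fin (n + 1)) ≠ Fin.last n := by
    rintro h
    have := i.2
    have h1 := congrArg Fin.val h
    simp only [Fin.val_zero, Fin.val_last] at h1
    exact hi0 (Fin.ext (by simp; omega))
  let w : Fin (n + 1) → MvPolynomial (Fin 2) (acl S) := fun j =>
    if hj0 : j = 0 then C ⟨α, hα⟩ * X 0 + C ⟨β, hβ⟩
    else if hji : j = i then X 0
    else if hjl : j = Fin.last n then X 1
    else C ⟨x j, hS j hj0 hji hjl⟩
  have hwd : ∀ j, (w j).totalDegree ≤ 1 := by
    intro j
    simp only [w]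
    split_ifs
    · refine (totalDegree_add _ _).trans (max_le ((totalDegree_mul _ _).trans ?_) ?_) <;> simp
    all_goals simp
  have hw : ∀ y, aeval ![x i, y] (aeval w p) =
      eval (Function.update x (Fin.last n) y) (map (algebraMap (acl S) ℂ) p) := by
    intro y
    have : (fun j => aeval ![x i, y] (w j)) = Function.update x (Fin.last n) y := by
      funext j
      by_cases hj0 : j = 0
      · subst hj0
        simp only [w, dif_pos, map_add, map_mul, aeval_C, aeval_X, Function.update_of_ne hl0, h0]
        rfl
      by_cases hji : j = i
      · subst hji
        simp [w, hj0, Function.update_of_ne hil]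
      by_cases hjl : j = Fin.last n
      · subst hjl
        simp [w, hj0, hji]
      · simp [w, hj0, hji, hjl, Function.update_of_ne]
    rw [eval_map, ← this, ← AlgHom.comp_apply, comp_aeval]
    rfl
  obtain ⟨s, hs, s', hs', -, hss⟩ := exists_slope_of_zpow_mul_zpow_mem_acl (Θ := aeval w p)
    (fun hΘ => h' (by rw [← hw, hΘ, map_zero])) hxi hl
    (by rw [hw, Function.update_eq_self, h]) hM hm
  have hdeg : ∀ s ∈ (aeval w p).support, ∀ j : Fin 2,
      s j < (map (algebraMap (acl S) ℂ) p).totalDegree + 1 := by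
    intro s hs j
    refine Nat.lt_succ_of_le (le_trans (le_trans ?_ (le_totalDegree hs))
      ((totalDegree_aeval_le hwd p).trans (le_of_eq ?_)))
    · rw [Finsupp.sum_fintype _ _ fun _ => rfl]
      exact Finset.single_le_sum (f := fun j => s j) (fun _ _ => Nat.zero_le _) (Finset.mem_univ j)
    · rw [totalDegree, totalDegree,
        support_map_of_injective p (FaithfulSMul.algebraMap_injective (acl S) ℂ)]
  refine Finset.mem_image.2 ⟨((s 0, s' 0), (s 1, s' 1)), ?_, hss.symm⟩
  simp only [Finset.mem_product, Finset.mem_range]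
  exact ⟨⟨hdeg s hs 0, hdeg s' hs' 0⟩, ⟨hdeg s hs 1, hdeg s' hs' 1⟩⟩

theorem intCast_mem_acl (S : Set ℂ) (n : ℤ) : (n : ℂ) ∈ acl S := intCast_mem _ n

theorem mem_acl_of_sum_eq_zero {ι : Type*} {s : Finset ι} {c : ι → ℤ} {v : ι → ℂ} {S : Set ℂ}
    {j : ι} (hj : j ∈ s) (hcj : c j ≠ 0) (h : ∑ i ∈ s, (c i : ℂ) * v i = 0)
    (hS : ∀ i ∈ s, i ≠ j → c i ≠ 0 → v i ∈ acl S) : v j ∈ acl S := by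
  classical
  refine mem_acl_of_mul_mem (intCast_mem_acl S (c j)) (by exact_mod_cast hcj) ?_
  rw [← Finset.add_sum_erase _ _ hj] at h
  rw [eq_neg_of_add_eq_zero_left h]
  refine neg_mem (sum_mem fun i hi => ?_)
  by_cases hci : c i = 0
  · simp [hci]
  · exact mul_mem (intCast_mem_acl S _)
      (hS i (Finset.mem_of_mem_erase hi) (Finset.ne_of_mem_erase hi) hci)

theorem mem_acl_of_prod_eq_one {ι : Type*} {s : Finset ι} {c : ι → ℤ} {v : ι → ℂ} {S : Set ℂ}
    {j : ι} (hj : j ∈ s) (hcj : c j ≠ 0) (h : ∏ i ∈ s, v i ^ c i = 1)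
    (hS : ∀ i ∈ s, i ≠ j → c i ≠ 0 → v i ∈ acl S) : v j ∈ acl S := by
  classical
  refine mem_acl_of_zpow_mem hcj ?_
  rw [← Finset.mul_prod_erase _ _ hj] at h
  rw [eq_inv_of_mul_eq_one_left h]
  refine inv_mem_acl (prod_mem fun i hi => ?_)
  by_cases hci : c i = 0
  · simp [hci]
  · exact zpow_mem_acl (hS i (Finset.mem_of_mem_erase hi) (Finset.ne_of_mem_erase hi) hci) _

theorem exists_int_relation {k : ℕ} {x : ℕ → ℂ}
    (h : ¬ LinearIndependent ℚ fun i : Fin k => x i) :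
    ∃ t < k, ∃ m : ℕ → ℤ, 0 < m t ∧ ∑ i ∈ Finset.range (t + 1), (m i : ℂ) * x i = 0 := by
  rw [← LinearIndependent.iff_fractionRing ℤ ℚ, Fintype.not_linearIndependent_iff] at h
  obtain ⟨g, hg, i, hi⟩ := h
  let m : ℕ → ℤ := fun j => if hj : j < k then g ⟨j, hj⟩ else 0
  have hm : ∑ j ∈ Finset.range k, (m j : ℂ) * x j = 0 := by
    rw [← Fin.sum_univ_eq_sum_range (fun j => (m j : ℂ) * x j), ← hg]
    exact Finset.sum_congr rfl fun j _ => by simp [m]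
  let t := Nat.findGreatest (fun j => m j ≠ 0) k
  have hmi : m i ≠ 0 := by simpa [m] using hi
  have ht : m t ≠ 0 := Nat.findGreatest_spec (P := fun j => m j ≠ 0) i.2.le hmi
  have htk : t < k := by
    by_contra hlt
    exact ht (by simp [m, hlt])
  have hgt : ∀ j, t < j → m j = 0 := by
    intro j hj
    by_cases hjk : j ≤ k
    · by_contra hne
      exact (Nat.le_findGreatest (P := fun j => m j ≠ 0) hjk hne).not_gt hj
    · simp only [m, dif_neg (show ¬ j < k by omega)]
  have hm' : ∑ j ∈ Finset.range (t + 1), (m j : ℂ) * x j = 0 := by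
    rw [← hm]
    refine Finset.sum_subset (Finset.range_mono htk) fun j _ hj => ?_
    rw [hgt j (by simpa [Nat.succ_le_iff] using hj), Int.cast_zero, zero_mul]
  rcases ht.lt_or_gt with hneg | hpos
  · exact ⟨t, htk, fun j => -m j, by simpa using hneg, by simpa using hm'⟩
  · exact ⟨t, htk, m, hpos, hm'⟩

theorem prod_iterExp_zpow_eq_one {a : ℂ} {s : Finset ℕ} {m : ℕ → ℤ}
    (h : ∑ i ∈ s, (m i : ℂ) * iterExp i a = 0) : ∏ i ∈ s, iterExp (i + 1) a ^ m i = 1 := by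
  rw [← Complex.exp_zero, ← h, Complex.exp_sum]
  exact Finset.prod_congr rfl fun i _ => (Complex.exp_int_mul _ _).symm

theorem iterExp_succ_ne_zero (i : ℕ) (a : ℂ) : iterExp (i + 1) a ≠ 0 := Complex.exp_ne_zero _

theorem eRk_le_card {k : ℕ} {x : ℕ → ℂ} {T : Finset ℕ} (h : ∀ i ≤ k, x i ∈ acl (x '' T)) :
    algIndepMatroid.eRk (Set.range fun i : Fin (k + 1) => x i) ≤ T.card := by
  have hsub : (Set.range fun i : Fin (k + 1) => x i) ⊆ acl (x '' T) :=
    Set.range_subset_iff.2 fun i => h i (Nat.lt_succ_iff.1 i.2)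
  refine (eRk_le_of_subset_acl hsub).trans
    ((algIndepMatroid.eRk_le_encard _).trans ((Set.encard_image_le _ _).trans ?_))
  rw [Set.encard_coe_eq_coe_finsetCard]

/-- If the transcendence degree of `a, e₁(a), …` is one, Schanuel's conjecture forces
`a = 0` or `e₁(a) = a`. -/
theorem eRk_ne_one (hSC : SchanuelConjecture) {k : ℕ} (hk : 3 ≤ k) {a : ℂ}
    (h0 : iterExp 0 a ≠ 0) (h1 : iterExp 1 a ≠ iterExp 0 a) :
    algIndepMatroid.eRk (Set.range fun i : Fin (k + 1) => iterExp i.1 a) ≠ 1 := by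
  intro hd
  have hmem : ∀ i ≤ k, iterExp i a ∈ Set.range fun i : Fin (k + 1) => iterExp i.1 a :=
    fun i hi => ⟨⟨i, by omega⟩, rfl⟩
  have hdep : ∀ i, i + 2 ≤ k → ∃ c e : ℤ, (c ≠ 0 ∨ e ≠ 0) ∧
      (c : ℂ) * iterExp i a + e * iterExp (i + 1) a = 0 := by
    intro i hi
    have : ¬ LinearIndependent ℚ fun j : Fin 2 => iterExp (i + j.1) a := by
      intro hli
      have := hSC.le_eRk hli (S := Set.range fun i : Fin (k + 1) => iterExp i.1 a)
        (fun j => hmem _ (by omega)) (fun j => hmem (i + j.1 + 1) (by omega))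
      rw [hd] at this
      norm_num at this
    rw [← LinearIndependent.iff_fractionRing ℤ ℚ, Fintype.not_linearIndependent_iff] at this
    obtain ⟨g, hg, j, hj⟩ := this
    refine ⟨g 0, g 1, ?_, by simpa [Fin.sum_univ_two] using hg⟩
    fin_cases j
    · exact Or.inl hj
    · exact Or.inr hj
  have hx1 : iterExp 1 a ≠ 0 := iterExp_succ_ne_zero 0 a
  have hx2 : iterExp 2 a ≠ 0 := iterExp_succ_ne_zero 1 a
  obtain ⟨c, e, hce, h⟩ := hdep 0 (by omega)
  obtain ⟨c', e', hce', h'⟩ := hdep 1 (by omega)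
  simp only [zero_add, Nat.reduceAdd] at h h'
  have key : ∀ {c e : ℤ} {u v : ℂ}, u ≠ 0 → v ≠ 0 → (c ≠ 0 ∨ e ≠ 0) → (c : ℂ) * u + e * v = 0 →
      c ≠ 0 ∧ e ≠ 0 := by
    intro c e u v hu hv hce h
    constructor
    · rintro rfl
      simp_all
    · rintro rfl
      simp_all
  obtain ⟨hc, he⟩ := key h0 hx1 hce h
  obtain ⟨hc', he'⟩ := key hx1 hx2 hce' h'
  have hx1mem : iterExp 1 a ∉ acl ∅ := by
    intro hmem1
    have hmem0 : iterExp 0 a ∈ acl ∅ := by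
      refine mem_acl_of_mul_mem (intCast_mem_acl _ c) (by exact_mod_cast hc) ?_
      rw [eq_neg_of_add_eq_zero_left h]
      exact neg_mem (mul_mem (intCast_mem_acl _ _) hmem1)
    have hli : LinearIndependent ℚ fun _ : Fin 1 => iterExp 0 a :=
      LinearIndependent.of_subsingleton 0 h0
    have h2 := hSC.le_eRk hli (S := {iterExp 0 a, iterExp 1 a}) (by simp) (by simp [iterExp])
    have h3 := eRk_le_of_subset_acl (S := {iterExp 0 a, iterExp 1 a}) (T := ∅)
      (Set.insert_subset hmem0 (Set.singleton_subset_iff.2 hmem1))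
    rw [Matroid.eRk_empty] at h3
    have := h2.trans h3
    norm_num at this
  have hexp : iterExp 1 a ^ c * iterExp 2 a ^ e = 1 := by
    rw [show iterExp 2 a = Complex.exp (iterExp 1 a) from rfl,
      show iterExp 1 a = Complex.exp (iterExp 0 a) from rfl, ← Complex.exp_int_mul,
      ← Complex.exp_int_mul, ← Complex.exp_add]
    exact (congrArg Complex.exp h).trans Complex.exp_zero
  have hx2' : iterExp 2 a = (-(c' : ℂ) / e') * iterExp 1 a := by
    have : (e' : ℂ) ≠ 0 := by exact_mod_cast he'
    field_simp
    linear_combination h'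
  rw [hx2', mul_zpow] at hexp
  have hq : (-(c' : ℂ) / e') ∈ acl ∅ := by
    rw [div_eq_mul_inv]
    exact mul_mem (neg_mem (intCast_mem_acl _ _)) (inv_mem_acl (intCast_mem_acl _ _))
  by_cases hs : c + e = 0
  · apply h1
    have hce0 : (c : ℂ) + e = 0 := by exact_mod_cast hs
    have hc0 : (c : ℂ) ≠ 0 := by exact_mod_cast hc
    refine mul_left_cancel₀ hc0 ?_
    linear_combination -h + iterExp 1 a * hce0
  · refine hx1mem (mem_acl_of_zpow_mem hs ?_)
    have : iterExp 1 a ^ (c + e) * (-(c' : ℂ) / e') ^ e = 1 := by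
      rw [← hexp, zpow_add₀ hx1]
      ring
    rw [eq_inv_of_mul_eq_one_left this]
    exact inv_mem_acl (zpow_mem_acl hq e)

theorem eRk_ne_pred (hSC : SchanuelConjecture) {n : ℕ} {a : ℂ} (h0 : a ≠ 0)
    (hlast : ∀ U, (∀ i ≤ n + 1, iterExp i a ∈ acl U) → iterExp (n + 2) a ∈ acl U)
    (hfirst : ∀ U, (∀ i, 0 < i → i ≤ n + 2 → iterExp i a ∈ acl U) → iterExp 0 a ∈ acl U)
    {Sl : Finset ℚ}
    (hslope : ∀ i ∈ Finset.Ioc 0 (n + 1), ∀ U, ∀ α ∈ acl U, ∀ β ∈ acl U,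
      iterExp 0 a = α * iterExp i a + β → iterExp i a ∉ acl U →
      (∀ j ∈ Finset.Ioc 0 (n + 1), j ≠ i → iterExp j a ∈ acl U) → ∀ M : ℕ, M ≠ 0 → ∀ m : ℤ,
      iterExp (n + 2) a ^ M * iterExp i a ^ m ∈ acl U → (m : ℚ) / M ∈ Sl)
    (hrel : ∀ ρ : ℕ → ℚ, (∀ i ≤ n, ρ i ∈ Sl) →
      iterExp (n + 1) a + ∑ i ∈ Finset.range (n + 1), (ρ i : ℂ) * iterExp i a ≠ 0) :
    algIndepMatroid.eRk (Set.range fun i : Fin (n + 3) => iterExp i.1 a) ≠ (n + 1 : ℕ) := by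
  intro hd
  have hdim : ∀ T : Finset ℕ, T.card ≤ n → (∀ i ≤ n + 2, iterExp i a ∈ acl ((iterExp · a) '' T)) →
      False := by
    intro T hT h
    have h1 := eRk_le_card (x := (iterExp · a)) h
    rw [hd] at h1
    have : n + 1 ≤ T.card := by exact_mod_cast h1
    omega
  have hdep : ¬ LinearIndependent ℚ fun i : Fin (n + 2) => iterExp i.1 a := by
    intro hli
    have h1 := hSC.le_eRk hli (S := Set.range fun i : Fin (n + 3) => iterExp i.1 a)
      (fun j => ⟨j.castSucc, rfl⟩) (fun j => ⟨j.succ, rfl⟩)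
    rw [hd] at h1
    have : n + 2 ≤ n + 1 := by exact_mod_cast h1
    omega
  obtain ⟨t, ht, m, hmt, hsum⟩ := exists_int_relation (x := (iterExp · a)) hdep
  have hprod := prod_iterExp_zpow_eq_one hsum
  have htt : t ∈ Finset.range (t + 1) := Finset.self_mem_range_succ t
  have hmemT : ∀ (T : Finset ℕ), ∀ i ∈ T, iterExp i a ∈ acl ((iterExp · a) '' T) :=
    fun T i hi => subset_acl _ ⟨i, hi, rfl⟩
  rcases Nat.eq_zero_or_pos t with rfl | ht0
  · simp only [zero_add, Finset.range_one, Finset.sum_singleton, mul_eq_zero, Int.cast_eq_zero]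
      at hsum
    exact hsum.elim hmt.ne' h0
  rcases (Nat.lt_succ_iff.1 ht).lt_or_eq with htn | rfl
  · set T := (Finset.range (n + 2)).erase t |>.erase (t + 1) with hT
    have hcard : T.card = n := by
      rw [hT, Finset.card_erase_of_mem, Finset.card_erase_of_mem, Finset.card_range] <;>
        simp <;> omega
    have hTmem : ∀ i ≤ n + 1, i ≠ t → i ≠ t + 1 → iterExp i a ∈ acl ((iterExp · a) '' T) := by
      intro i hi h1 h2
      refine hmemT T i ?_
      simp only [hT, Finset.mem_erase, Finset.mem_range]
      omega
    have h1 : iterExp t a ∈ acl ((iterExp · a) '' T) := by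
      refine mem_acl_of_sum_eq_zero (v := (iterExp · a)) htt hmt.ne' hsum fun i hi hit _ => ?_
      have := Finset.mem_range.1 hi
      exact hTmem i (by omega) hit (by omega)
    have h2 : iterExp (t + 1) a ∈ acl ((iterExp · a) '' T) := by
      refine mem_acl_of_prod_eq_one (v := fun i => iterExp (i + 1) a) htt hmt.ne' hprod
        fun i hi hit _ => ?_
      have := Finset.mem_range.1 hi
      by_cases hi1 : i + 1 = t
      · rwa [hi1]
      · exact hTmem (i + 1) (by omega) hi1 (by omega)
    have h3 : ∀ i ≤ n + 1, iterExp i a ∈ acl ((iterExp · a) '' T) := by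
      intro i hi
      by_cases hit : i = t
      · rwa [hit]
      by_cases hit' : i = t + 1
      · rwa [hit']
      exact hTmem i hi hit hit'
    refine hdim T hcard.le fun i hi => ?_
    rcases hi.lt_or_eq with hi | rfl
    · exact h3 i (by omega)
    · exact hlast _ h3
  have hall : ∀ U, (∀ i ∈ Finset.Ioc 0 (n + 1), iterExp i a ∈ acl U) →
      ∀ i ≤ n + 2, iterExp i a ∈ acl U := by
    intro U hU
    have h1 : iterExp (n + 2) a ∈ acl U := by
      refine mem_acl_of_prod_eq_one (v := fun i => iterExp (i + 1) a) htt hmt.ne' hprod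
        fun i hi hit _ => hU _ ?_
      have := Finset.mem_range.1 hi
      simp only [Finset.mem_Ioc]
      omega
    have h2 : ∀ i, 0 < i → i ≤ n + 2 → iterExp i a ∈ acl U := by
      intro i hi hi'
      rcases hi'.lt_or_eq with hi' | rfl
      · exact hU i (Finset.mem_Ioc.2 ⟨hi, by omega⟩)
      · exact h1
    intro i hi
    rcases Nat.eq_zero_or_pos i with rfl | hi0
    · exact hfirst U h2
    · exact h2 i hi0 hi
  by_cases hm0 : m 0 = 0
  · refine hdim (Finset.Ioc 0 n) (by simp) (hall _ fun i hi => ?_)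
    rw [Finset.mem_Ioc] at hi
    rcases hi.2.lt_or_eq with hi' | rfl
    · exact hmemT _ i (Finset.mem_Ioc.2 ⟨hi.1, by omega⟩)
    · refine mem_acl_of_sum_eq_zero (v := (iterExp · a)) htt hmt.ne' hsum fun i hi hit hmi => ?_
      refine hmemT _ i (Finset.mem_Ioc.2 ⟨Nat.pos_of_ne_zero ?_, ?_⟩)
      · rintro rfl
        exact hmi hm0
      · have := Finset.mem_range.1 hi
        omega
  obtain ⟨M, hM⟩ := Int.eq_ofNat_of_zero_le hmt.le
  have hM0 : M ≠ 0 := by rintro rfl; exact hmt.ne' hM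
  have hsl : ∀ i ≤ n, (m i : ℚ) / M ∈ Sl := by
    intro i hi
    set T := (Finset.Ioc 0 (n + 1)).erase (i + 1) with hT
    have hiT : i + 1 ∈ Finset.Ioc 0 (n + 1) := by simp [hi]
    have hTm : ∀ j ∈ Finset.Ioc 0 (n + 1), j ≠ i + 1 → iterExp j a ∈ acl ((iterExp · a) '' T) :=
      fun j hj hji => hmemT T j (Finset.mem_erase.2 ⟨hji, hj⟩)
    have hnot : iterExp (i + 1) a ∉ acl ((iterExp · a) '' T) := by
      intro hmem
      refine hdim T (by rw [hT, Finset.card_erase_of_mem hiT]; simp) (hall _ fun j hj => ?_)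
      by_cases hji : j = i + 1
      · rwa [hji]
      · exact hTm j hj hji
    have hm0' : (m 0 : ℂ) ≠ 0 := by exact_mod_cast hm0
    refine hslope (i + 1) hiT ((iterExp · a) '' T) (-(m (i + 1) : ℂ) * (m 0 : ℂ)⁻¹)
      (mul_mem (neg_mem (intCast_mem_acl _ _)) (inv_mem_acl (intCast_mem_acl _ _)))
      (-(m 0 : ℂ)⁻¹ * ∑ j ∈ T, (m j : ℂ) * iterExp j a)
      (mul_mem (neg_mem (inv_mem_acl (intCast_mem_acl _ _)))
        (sum_mem fun j hj => mul_mem (intCast_mem_acl _ _) (hmemT T j hj)))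
      ?_ hnot hTm M hM0 (m i) ?_
    · have h1 : Finset.range (n + 1 + 1) = insert 0 (Finset.Ioc 0 (n + 1)) := by
        ext j
        simp only [Finset.mem_range, Finset.mem_insert, Finset.mem_Ioc]
        omega
      rw [h1, Finset.sum_insert (by simp), ← Finset.add_sum_erase _ _ hiT, ← hT] at hsum
      field_simp
      linear_combination hsum
    · rw [Finset.prod_range_succ, hM, zpow_natCast,
        ← Finset.mul_prod_erase _ _ (Finset.mem_range.2 (Nat.lt_succ_of_le hi)), mul_assoc,
        mul_comm (∏ _ ∈ _, _), ← mul_assoc, mul_comm (iterExp (i + 1) a ^ m i)] at hprod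
      rw [eq_inv_of_mul_eq_one_left hprod]
      refine inv_mem_acl (prod_mem fun j hj => zpow_mem_acl (hTm _ ?_ ?_) _)
      · have := Finset.mem_range.1 (Finset.mem_of_mem_erase hj)
        simp only [Finset.mem_Ioc]
        omega
      · have := Finset.ne_of_mem_erase hj
        omega
  refine hrel (fun i => (m i : ℚ) / M) hsl ?_
  have hMC : (M : ℂ) ≠ 0 := by exact_mod_cast hM0
  have h1 : ∑ i ∈ Finset.range (n + 1), (((m i : ℚ) / M : ℚ) : ℂ) * iterExp i a =
      (M : ℂ)⁻¹ * ∑ i ∈ Finset.range (n + 1), (m i : ℂ) * iterExp i a := by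
    rw [Finset.mul_sum]
    refine Finset.sum_congr rfl fun i _ => ?_
    push_cast
    ring
  rw [Finset.sum_range_succ, hM] at hsum
  rw [h1, eq_neg_of_add_eq_zero_left hsum]
  push_cast
  field_simp
  ring

theorem exists_generic_iterExp_zero {n : ℕ} {p : MvPolynomial (Fin (n + 3)) ℂ}
    (hp : Irreducible p) (h0 : degreeOf 0 p ≠ 0) (hl : degreeOf (Fin.last (n + 2)) p ≠ 0)
    (Sl : Finset ℚ) :
    ∃ a : ℂ, eval (fun i : Fin (n + 3) => iterExp i.1 a) p = 0 ∧ a ≠ 0 ∧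
      iterExp 1 a ≠ iterExp 0 a ∧
      eval (Function.update (fun i : Fin (n + 3) => iterExp i.1 a) (Fin.last (n + 2)) 0) p ≠ 0 ∧
      eval (Function.update (fun i : Fin (n + 3) => iterExp i.1 a) 0 0) p ≠ 0 ∧
      ∀ ρ : ℕ → ℚ, (∀ i ≤ n, ρ i ∈ Sl) →
        iterExp (n + 1) a + ∑ i ∈ Finset.range (n + 1), (ρ i : ℂ) * iterExp i a ≠ 0 := by
  have hc0 : (lastVarEquiv (n + 2) p).coeff 0 ≠ 0 :=
    lastVarEquiv_coeff_zero_ne_zero (i := 0) hp h0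
  obtain ⟨Qe, hQe, hQe'⟩ := exists_eliminant hp h0 hl
  let F : (Fin (n + 1) → ℚ) → MvPolynomial (Fin (n + 2)) ℂ := fun ρ =>
    X (Fin.last (n + 1)) + ∑ i, C (ρ i : ℂ) * X i.castSucc
  have hF : ∀ ρ, F ρ ≠ 0 := by
    intro ρ h
    have := congrArg (eval (Pi.single (Fin.last (n + 1)) (1 : ℂ))) h
    simp [F] at this
  have hX : (X 1 - X 0 : MvPolynomial (Fin (n + 2)) ℂ) ≠ 0 := by
    rw [sub_ne_zero]
    exact fun h => one_ne_zero (X_injective h)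
  obtain ⟨a, ha, hQ⟩ := exists_iterExp_zero_avoiding p hc0 hl
    (X 0 * (X 1 - X 0) * (lastVarEquiv (n + 2) p).coeff 0 * Qe *
      ∏ ρ ∈ Fintype.piFinset (fun _ : Fin (n + 1) => Sl), F ρ)
    (mul_ne_zero (mul_ne_zero (mul_ne_zero (mul_ne_zero (X_ne_zero 0) hX) hc0) hQe)
      (Finset.prod_ne_zero_iff.2 fun ρ _ => hF ρ))
  simp only [map_mul, map_sub, eval_X, map_prod, mul_ne_zero_iff, Finset.prod_ne_zero_iff,
    sub_ne_zero] at hQ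
  obtain ⟨⟨⟨⟨h1, h2⟩, h3⟩, h4⟩, h5⟩ := hQ
  refine ⟨a, ha, h1, h2, ?_, fun h => h4 ?_, fun ρ hρ h => ?_⟩
  · rw [← eval_map_lastVarEquiv, Function.update_self, ← Polynomial.coeff_zero_eq_eval_zero,
      Polynomial.coeff_map]
    convert h3 using 3
    funext i
    simp
  · exact hQe' (fun i : Fin (n + 3) => iterExp i.1 a) ha h
  · refine h5 (fun i => ρ i) (Fintype.mem_piFinset.2 fun i => hρ i (by omega)) ?_
    rw [← h, ← Fin.sum_univ_eq_sum_range (fun i => (ρ i : ℂ) * iterExp i a)]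
    simp [F]

/-- (SC) For `k ≥ 2` and a nonzero irreducible `p ∈ ℚ^alg[x₀,…,x_k]`
depending on `x₀` and `x_k`, there is a solution `a ∈ ℂ` of
`p(a, e₁(a), …, e_k(a)) = 0` whose transcendence degree
`td_ℚ(a, e₁(a), …, e_k(a))` is not `0`, `1`, or `k − 1`. -/
theorem solution_trdeg_not_zero_one_pred
    (hSC : SchanuelConjecture) {k : ℕ} (hk : 2 ≤ k)
    (p : MvPolynomial (Fin (k + 1)) ℂ)
    (hcoeff : ∀ mo : Fin (k + 1) →₀ ℕ, IsAlgebraic ℚ (MvPolynomial.coeff mo p))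
    (hp0 : p ≠ 0) (hirr : Irreducible p)
    (hx0 : MvPolynomial.degreeOf 0 p ≠ 0)
    (hxk : MvPolynomial.degreeOf (Fin.last k) p ≠ 0) :
    ∃ a : ℂ,
      MvPolynomial.eval (fun i : Fin (k + 1) => iterExp i.1 a) p = 0 ∧
      ∃ d : ℕ,
        HasTrdeg (Set.range (fun i : Fin (k + 1) => iterExp i.1 a)) d ∧
        d ≠ 0 ∧ d ≠ 1 ∧ d ≠ k - 1 := by
  obtain ⟨n, rfl⟩ : ∃ n, k = n + 2 := ⟨k - 2, by omega⟩
  obtain ⟨a, ha, h0, h1, hlast, hfirst, hrel⟩ :=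
    exists_generic_iterExp_zero hirr hx0 hxk (slopes p.totalDegree)
  have hcoeff' : ∀ U mo, coeff mo p ∈ acl U := fun U mo => mem_acl_of_isAlgebraic_rat (hcoeff mo)
  refine ⟨a, ha, ?_⟩
  set W := Set.range fun i : Fin (n + 2 + 1) => iterExp i.1 a with hW
  have hlast' : ∀ U, (∀ i ≤ n + 1, iterExp i a ∈ acl U) → iterExp (n + 2) a ∈ acl U := by
    intro U hU
    by_contra hnot
    refine hlast (eval_update_eq_zero_of_not_mem_acl (hcoeff' U) (fun j hj => hU j ?_) hnot ha 0)
    have := Fin.val_lt_last hj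
    omega
  have hfirst' : ∀ U, (∀ i, 0 < i → i ≤ n + 2 → iterExp i a ∈ acl U) → iterExp 0 a ∈ acl U := by
    intro U hU
    by_contra hnot
    refine hfirst (eval_update_eq_zero_of_not_mem_acl (hcoeff' U)
      (fun j hj => hU j ?_ (Nat.lt_succ_iff.1 j.2)) hnot ha 0)
    exact Fin.pos_iff_ne_zero.2 hj
  have hpred := eRk_ne_pred hSC h0 hlast' hfirst' (Sl := slopes p.totalDegree) (by
    intro i hi U α hα β hβ hαβ hnot hU M hM m hm
    rw [Finset.mem_Ioc] at hi
    have hi0 : (⟨i, by omega⟩ : Fin (n + 2 + 1)) ≠ 0 := fun h => hi.1.ne' (congrArg Fin.val h)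
    have hil : (⟨i, by omega⟩ : Fin (n + 2 + 1)) ≠ Fin.last (n + 2) := fun h => by
      have : i = n + 2 := congrArg Fin.val h
      omega
    refine div_mem_slopes (hcoeff' U) (i := ⟨i, by omega⟩) hi0 hil (fun j hj0 hji hjl => ?_) hnot
      hα hβ hαβ (iterExp_succ_ne_zero (n + 1) a) ha hlast hM hm
    refine hU j (Finset.mem_Ioc.2 ⟨Fin.pos_iff_ne_zero.2 hj0, ?_⟩) fun h => hji (Fin.ext h)
    have := Fin.val_lt_last hjl
    omega) hrel
  have hfin : algIndepMatroid.eRk W ≠ ⊤ :=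
    ne_top_of_le_ne_top (Set.encard_ne_top_iff.2 (Set.finite_range _))
      (algIndepMatroid.eRk_le_encard W)
  obtain ⟨d, hd⟩ := ENat.ne_top_iff_exists.1 hfin
  have hd' : d ≠ n + 1 := by
    rintro rfl
    exact hpred hd.symm
  refine ⟨d, hasTrdeg_of_eRk_eq hd.symm, ?_, ?_, by simpa using hd'⟩
  · rintro rfl
    have hli : LinearIndependent ℚ fun _ : Fin 1 => a := LinearIndependent.of_subsingleton 0 h0
    have := hSC.le_eRk hli (S := W) (fun _ => ⟨0, rfl⟩) (fun _ => ⟨1, rfl⟩)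
    rw [← hd] at this
    norm_num at this
  · rintro rfl
    rcases n with _ | n
    · exact hd' rfl
    · exact eRk_ne_one hSC (k := n + 3) (by omega) h0 h1 (by rw [← hW, ← hd, Nat.cast_one])
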